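/- arXiv:1510.06467 — 2 statements merged into one kernel-verified Lean document; each statement's English description precedes it below -/
import Mathlib

section
/- Let Φ = {φ_j}_{j=1}^N be a self-similar system on ℝ satisfying the open set condition, with attractor F and scaling vector r = (r_j) such that ∑_{j=1}^N r_j < 1 (so 0 < D_r < 1). Then F is Minkowski measurable — i.e., the limit lim_{ε→0⁺} vol¹(F_ε)/ε^{1−D_r} exists and lies in (0,∞), where F_ε is the open ε-neighborhood of F and vol¹ is one-dimensional Lebesgue measure — if and only if the scaling vector r is nonlattice. -/
open Filter Topology Metric MeasureTheory

/-- A scaling vector is *lattice* if its components are powers `ρ ^ (k j)` of a common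
ratio `ρ ∈ (0,1)` with positive integer exponents whose gcd is `1`. -/
def IsLatticeVec {N : ℕ} (r : Fin N → ℝ) : Prop :=
  ∃ (ρ : ℝ) (k : Fin N → ℕ), ρ ∈ Set.Ioo (0 : ℝ) 1 ∧ (∀ j, 0 < k j) ∧
    Finset.univ.gcd k = 1 ∧ ∀ j, r j = ρ ^ (k j)

/-- `φ` is a contracting similarity on `ℝ` with scaling ratio `ρ`. -/
def IsSimilarityR (φ : ℝ → ℝ) (ρ : ℝ) : Prop :=
  ∀ x y, dist (φ x) (φ y) = ρ * dist x y

/-- The length of the open `ε`-neighbourhood of a set of reals. -/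
noncomputable def tubeVol (F : Set ℝ) (ε : ℝ) : ℝ := (volume (thickening ε F)).toReal

theorem tubeVol_nonneg (F : Set ℝ) (ε : ℝ) : 0 ≤ tubeVol F ε := ENNReal.toReal_nonneg

theorem volume_thickening_ne_top {F : Set ℝ} (hF : Bornology.IsBounded F) (ε : ℝ) :
    volume (thickening ε F) ≠ ⊤ :=
  hF.thickening.measure_lt_top.ne

theorem tubeVol_mono_of_subset {E F : Set ℝ} (hF : Bornology.IsBounded F) {δ ε : ℝ}
    (h : thickening δ E ⊆ thickening ε F) : tubeVol E δ ≤ tubeVol F ε :=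
  ENNReal.toReal_mono (volume_thickening_ne_top hF ε) (measure_mono h)

theorem tubeVol_mono {F : Set ℝ} (hF : Bornology.IsBounded F) : Monotone (tubeVol F) :=
  fun _ _ h => tubeVol_mono_of_subset hF (thickening_mono h F)

theorem tubeVol_singleton (x : ℝ) {ε : ℝ} (hε : 0 < ε) : tubeVol {x} ε = 2 * ε := by
  rw [tubeVol, thickening_singleton, Real.volume_ball, ENNReal.toReal_ofReal (by positivity)]

/-- Adding a new largest point, at distance `x - y` of the old one, to a bounded set. -/
theorem tubeVol_insert {s : Set ℝ} (hs : Bornology.IsBounded s) {x y : ℝ} (hy : y ∈ s)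
    (hmax : ∀ z ∈ s, z ≤ y) (hxy : y < x) {ε : ℝ} (hε : 0 < ε) :
    tubeVol (insert x s) ε = tubeVol s ε + min (x - y) (2 * ε) := by
  have hun : thickening ε (insert x s) = thickening ε s ∪ ball x ε := by
    rw [Set.insert_eq, thickening_union, thickening_singleton, Set.union_comm]
  have hint : thickening ε s ∩ ball x ε = Set.Ioo (x - ε) (y + ε) := by
    ext z
    simp only [Set.mem_inter_iff, mem_thickening_iff, mem_ball, Set.mem_Ioo, Real.dist_eq, abs_lt]
    constructor
    · rintro ⟨⟨w, hw, h1, h2⟩, h3, h4⟩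
      have := hmax w hw
      constructor <;> linarith
    · rintro ⟨h1, h2⟩
      exact ⟨⟨y, hy, by linarith, by linarith⟩, by linarith, by linarith⟩
  have key := measureReal_union_add_inter (μ := volume) (s := thickening ε s) (t := ball x ε)
    measurableSet_ball (volume_thickening_ne_top hs ε) measure_ball_lt_top.ne
  rw [hint, ← hun] at key
  simp only [Measure.real, Real.volume_Ioo, Real.volume_ball] at key
  rw [ENNReal.toReal_ofReal (by positivity : 0 ≤ 2 * ε), ENNReal.toReal_ofReal'] at key
  simp only [tubeVol]
  rcases le_total (x - y) (2 * ε) with h | h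
  · rw [max_eq_left (by linarith)] at key
    rw [min_eq_left h]; linarith
  · rw [max_eq_right (by linarith)] at key
    rw [min_eq_right h]; linarith

theorem Finset.exists_eq_max {s : Finset ℝ} (hs : s.Nonempty) : ∃ y ∈ s, ∀ z ∈ s, z ≤ y :=
  ⟨s.max' hs, s.max'_mem hs, fun z hz => s.le_max' z hz⟩

theorem tubeVol_finset_mul_le (K : Finset ℝ) {ε c : ℝ} (hε : 0 < ε) (hc : 1 ≤ c) :
    tubeVol K (c * ε) ≤ c * tubeVol K ε := by
  have hcε : 0 < c * ε := by positivity
  induction K using Finset.induction_on_max with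
  | empty => simp [tubeVol]
  | insert x s hx ih =>
    rcases s.eq_empty_or_nonempty with rfl | hs
    · simp only [insert_empty_eq, Finset.coe_singleton]
      rw [tubeVol_singleton x hcε, tubeVol_singleton x hε]; linarith
    · obtain ⟨y, hy, hmax⟩ := Finset.exists_eq_max hs
      have hb : Bornology.IsBounded (s : Set ℝ) := s.finite_toSet.isBounded
      rw [Finset.coe_insert, tubeVol_insert hb hy hmax (hx y hy) hcε,
        tubeVol_insert hb hy hmax (hx y hy) hε]
      have hg : 0 < x - y := sub_pos.2 (hx y hy)
      have : min (x - y) (2 * (c * ε)) ≤ c * min (x - y) (2 * ε) := by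
        rcases le_total (x - y) (2 * ε) with h | h
        · rw [min_eq_left h]; exact (min_le_left _ _).trans (by nlinarith)
        · rw [min_eq_right h]; exact (min_le_right _ _).trans (by linarith)
      linarith

/-- Each gap of length exactly `2 ε` contributes `-2 ε h` to a second difference of the
tube volume of a finite set; every other gap contributes a nonpositive amount. -/
theorem tubeVol_finset_second_diff (K : Finset ℝ) {ε h : ℝ} (hε : 0 < ε) (h0 : 0 < h) (h1 : h < 1)
    (A : Finset ℝ) (hA : ∀ a ∈ A, a ∈ K ∧ a + 2 * ε ∈ K ∧ ∀ x ∈ K, x ≤ a ∨ a + 2 * ε ≤ x) :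
    tubeVol K ((1 + h) * ε) + tubeVol K ((1 - h) * ε) - 2 * tubeVol K ε ≤
      -(2 * ε * h * A.card) := by
  have hp : 0 < (1 + h) * ε := by positivity
  have hm : 0 < (1 - h) * ε := mul_pos (by linarith) hε
  have hεh : 0 < ε * h := by positivity
  induction K using Finset.induction_on_max generalizing A with
  | empty =>
    have : A = ∅ := Finset.eq_empty_of_forall_notMem fun a ha => by simpa using (hA a ha).1
    simp [this, tubeVol]
  | insert x s hx ih =>
    rcases s.eq_empty_or_nonempty with rfl | hs
    · have : A = ∅ := Finset.eq_empty_of_forall_notMem fun a ha => by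
        obtain ⟨h1, h2, -⟩ := hA a ha
        simp only [insert_empty_eq, Finset.mem_singleton] at h1 h2
        linarith
      subst this
      simp only [insert_empty_eq, Finset.coe_singleton]
      rw [tubeVol_singleton x hp, tubeVol_singleton x hm, tubeVol_singleton x hε]
      simp; linarith
    · obtain ⟨y, hy, hmax⟩ := Finset.exists_eq_max hs
      have hb : Bornology.IsBounded (s : Set ℝ) := s.finite_toSet.isBounded
      rw [Finset.coe_insert, tubeVol_insert hb hy hmax (hx y hy) hp,
        tubeVol_insert hb hy hmax (hx y hy) hm, tubeVol_insert hb hy hmax (hx y hy) hε]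
      have hg : 0 < x - y := sub_pos.2 (hx y hy)
      have hmem : ∀ a ∈ A, a ∈ s ∧ (a + 2 * ε ∈ s ∨ a = y ∧ x - y = 2 * ε) ∧
          ∀ z ∈ s, z ≤ a ∨ a + 2 * ε ≤ z := by
        intro a ha
        obtain ⟨h1, h2, h3⟩ := hA a ha
        have hax : a ≠ x := by
          rintro rfl
          rcases Finset.mem_insert.1 h2 with h | h
          · linarith
          · linarith [hx _ h]
        have has := (Finset.mem_insert.1 h1).resolve_left hax
        refine ⟨has, ?_, fun z hz => h3 z (Finset.mem_insert_of_mem hz)⟩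
        rcases Finset.mem_insert.1 h2 with h | h
        · right
          rcases h3 y (Finset.mem_insert_of_mem hy) with h' | h'
          · have := le_antisymm (hmax a has) h'
            exact ⟨this, by rw [← this, ← h]; ring⟩
          · linarith [hx y hy]
        · exact Or.inl h
      by_cases hgap : x - y = 2 * ε
      · have := ih (A.erase y) (fun a ha => by
          obtain ⟨h1, h2, h3⟩ := hmem a (Finset.mem_of_mem_erase ha)
          exact ⟨h1, h2.resolve_right fun h => Finset.ne_of_mem_erase ha h.1, h3⟩)
        have hcard : (A.card : ℝ) ≤ (A.erase y).card + 1 := by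
          exact_mod_cast Nat.sub_le_iff_le_add.1 (Finset.pred_card_le_card_erase (s := A) (a := y))
        rw [hgap, min_eq_left (by nlinarith), min_eq_right (by nlinarith), min_self]
        nlinarith
      · have := ih A (fun a ha => by
          obtain ⟨h1, h2, h3⟩ := hmem a ha
          exact ⟨h1, h2.resolve_right fun h => hgap h.2, h3⟩)
        have hmin : min (x - y) (2 * ((1 + h) * ε)) + min (x - y) (2 * ((1 - h) * ε)) ≤
            2 * min (x - y) (2 * ε) := by
          rcases le_total (x - y) (2 * ε) with hl | hl
          · rw [min_eq_left hl]
            linarith [min_le_left (x - y) (2 * ((1 + h) * ε)),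
              min_le_left (x - y) (2 * ((1 - h) * ε))]
          · rw [min_eq_right hl]
            linarith [min_le_right (x - y) (2 * ((1 + h) * ε)),
              min_le_right (x - y) (2 * ((1 - h) * ε))]
        linarith

theorem IsCompact.exists_finset_thickening_subset {F : Set ℝ} (hF : IsCompact F) {δ : ℝ}
    (hδ : 0 < δ) : ∃ K : Finset ℝ, (K : Set ℝ) ⊆ F ∧ ∀ L : Finset ℝ, K ⊆ L →
      ∀ ε, thickening (ε - δ) F ⊆ thickening ε L := by
  obtain ⟨t, htF, htfin, hcov⟩ := hF.finite_cover_balls hδ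
  refine ⟨htfin.toFinset, by simpa using htF, fun L hL ε z hz => ?_⟩
  obtain ⟨x, hx, hzx⟩ := mem_thickening_iff.1 hz
  obtain ⟨y, hy, hxy⟩ := Set.mem_iUnion₂.1 (hcov hx)
  refine mem_thickening_iff.2 ⟨y, hL (by simpa using hy), ?_⟩
  have := dist_triangle z x y
  rw [mem_ball] at hxy
  linarith

theorem tubeVol_mul_le {F : Set ℝ} (hF : IsCompact F) {ε c : ℝ} (hε : 0 < ε) (hc : 1 ≤ c) :
    tubeVol F (c * ε) ≤ c * tubeVol F ε := by
  have key : ∀ d > c, tubeVol F (c * ε) ≤ d * tubeVol F ε := by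
    intro d hd
    obtain ⟨K, hKF, hK⟩ := hF.exists_finset_thickening_subset
      (mul_pos (sub_pos.2 hd) hε : 0 < (d - c) * ε)
    calc tubeVol F (c * ε) ≤ tubeVol K (d * ε) := by
          refine tubeVol_mono_of_subset K.finite_toSet.isBounded ?_
          convert hK K subset_rfl (d * ε) using 2; ring
      _ ≤ d * tubeVol K ε := tubeVol_finset_mul_le K hε (hc.trans hd.le)
      _ ≤ d * tubeVol F ε := by
          have := tubeVol_mono_of_subset hF.isBounded (thickening_subset_of_subset ε hKF)
          gcongr
          linarith
  have hlim : Tendsto (fun d : ℝ => d * tubeVol F ε) (𝓝[>] c) (𝓝 (c * tubeVol F ε)) :=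
    ((continuous_id.mul continuous_const).tendsto c).mono_left nhdsWithin_le_nhds
  exact ge_of_tendsto hlim (eventually_nhdsWithin_of_forall key)

theorem tubeVol_second_diff {F : Set ℝ} (hF : IsCompact F) {ε h δ : ℝ} (hε : 0 < ε) (h0 : 0 < h)
    (h1 : h < 1) (hδ : 0 < δ) (A : Finset ℝ)
    (hA : ∀ a ∈ A, a ∈ F ∧ a + 2 * ε ∈ F ∧ ∀ x ∈ F, x ≤ a ∨ a + 2 * ε ≤ x) :
    tubeVol F ((1 + h) * ε - δ) + tubeVol F ((1 - h) * ε - δ) - 2 * tubeVol F ε ≤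
      -(2 * ε * h * A.card) := by
  classical
  obtain ⟨K, hKF, hK⟩ := hF.exists_finset_thickening_subset hδ
  set L : Finset ℝ := K ∪ A ∪ A.image (· + 2 * ε) with hL
  have hKL : K ⊆ L := fun x hx => by simp [hL, hx]
  have hLF : (L : Set ℝ) ⊆ F := by
    intro x hx
    simp only [hL, Finset.coe_union, Finset.coe_image, Set.mem_union, Set.mem_image,
      Finset.mem_coe] at hx
    rcases hx with (hx | hx) | ⟨a, ha, rfl⟩
    · exact hKF hx
    · exact (hA x hx).1
    · exact (hA a ha).2.1
  have key := tubeVol_finset_second_diff L hε h0 h1 A fun a ha =>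
    ⟨by simp [hL, ha], Finset.mem_union_right _ (Finset.mem_image_of_mem _ ha),
      fun x hx => (hA a ha).2.2 x (hLF hx)⟩
  have hb : Bornology.IsBounded (L : Set ℝ) := L.finite_toSet.isBounded
  have e1 := tubeVol_mono_of_subset hb (hK L hKL ((1 + h) * ε))
  have e2 := tubeVol_mono_of_subset hb (hK L hKL ((1 - h) * ε))
  have e3 := tubeVol_mono_of_subset hF.isBounded (thickening_subset_of_subset ε hLF)
  linarith

section Renewal

variable {N : ℕ} {p τ : Fin N → ℝ} {f : ℝ → ℝ} {M : ℝ}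

/-- If `f` is close to its asymptotic upper bound `M` along a filter and `f` is dominated by its
`p`-average over the shifts by `τ`, then so are the shifts of `f`. -/
theorem tendsto_shift_of_mem_closure (hp : ∀ j, 0 < p j) (hp1 : ∑ j, p j = 1) {T : ℝ}
    (hsub : ∀ t ≥ T, f t ≤ ∑ j, p j * f (t - τ j))
    (hM : ∀ η > 0, ∀ᶠ t in atTop, f t < M + η) {l : Filter ℝ} (hl : l ≤ atTop)
    (hf : Tendsto f l (𝓝 M)) {s : ℝ} (hs : s ∈ AddSubmonoid.closure (Set.range τ)) :
    Tendsto (fun t => f (t - s)) l (𝓝 M) := by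
  have hshift : ∀ u : ℝ, Tendsto (fun t : ℝ => t - u) l atTop := fun u =>
    (tendsto_atTop_add_const_right atTop (-u) tendsto_id).mono_left hl
  induction hs using AddSubmonoid.closure_induction_right with
  | zero => simpa using hf
  | add_right s _ y hy ih =>
    obtain ⟨j, rfl⟩ := hy
    rw [tendsto_order]
    refine ⟨fun a ha => ?_, fun b hb => ?_⟩
    · set η := (M - a) * p j / 2 with hη
      have hη0 : 0 < η := by have := hp j; have : 0 < M - a := by linarith
                             positivity
      have h1 : ∀ᶠ t in l, M - η < f (t - s) := ih.eventually (lt_mem_nhds (by linarith))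
      have h2 : ∀ᶠ t in l, ∀ i, f (t - s - τ i) < M + η := by
        rw [eventually_all]
        intro i
        have := (hshift (s + τ i)).eventually (hM η hη0)
        filter_upwards [this] with t ht
        rwa [sub_sub]
      have h3 : ∀ᶠ t in l, T ≤ t - s := (hshift s).eventually (eventually_ge_atTop T)
      filter_upwards [h1, h2, h3] with t ht1 ht2 ht3
      have e1 := hsub _ ht3
      have e2 : ∑ i, p i * f (t - s - τ i) ≤
          p j * f (t - s - τ j) + (1 - p j) * (M + η) := by
        rw [← Finset.add_sum_erase _ _ (Finset.mem_univ j)]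
        have : ∑ i ∈ Finset.univ.erase j, p i * f (t - s - τ i) ≤
            ∑ i ∈ Finset.univ.erase j, p i * (M + η) :=
          Finset.sum_le_sum fun i _ => mul_le_mul_of_nonneg_left (ht2 i).le (hp i).le
        rw [← Finset.sum_mul] at this
        have h4 := Finset.add_sum_erase Finset.univ p (Finset.mem_univ j)
        have h5 : ∑ i ∈ Finset.univ.erase j, p i = 1 - p j := by linarith
        rw [h5] at this
        linarith
      rw [← sub_sub]
      have hpj := hp j
      by_contra hcon
      push Not at hcon
      have : p j * f (t - s - τ j) ≤ p j * a := mul_le_mul_of_nonneg_left hcon hpj.le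
      have h6 : (M - a) * p j = 2 * η := by rw [hη]; ring
      nlinarith
    · have := (hshift (s + τ j)).eventually (hM (b - M) (by linarith))
      filter_upwards [this] with t ht
      linarith

/-- If the group generated by `G` is dense then the monoid generated by `G` has arbitrarily
long, arbitrarily fine finite chains. -/
theorem exists_chain_of_dense_closure {G : Set ℝ}
    (hG : Dense (AddSubgroup.closure G : Set ℝ)) {δ L : ℝ} (hδ : 0 < δ) :
    ∃ S : Finset ℝ, (∀ s ∈ S, s ∈ AddSubmonoid.closure G) ∧
      ∃ b, ∀ x ∈ Set.Icc b (b + L), ∃ s ∈ S, |x - s| < δ := by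
  classical
  obtain ⟨d, hd0, hdδ, hd⟩ : ∃ d, 0 < d ∧ d < δ ∧ d ∈ AddSubgroup.closure G := by
    obtain ⟨d, hd, h⟩ := hG.exists_between hδ
    exact ⟨d, h.1, h.2, hd⟩
  obtain ⟨a, ha, b, hb, rfl⟩ : ∃ a ∈ AddSubmonoid.closure G, ∃ b ∈ AddSubmonoid.closure G,
      a - b = d := by
    clear hd0 hdδ
    induction hd using AddSubgroup.closure_induction with
    | mem x hx => exact ⟨x, AddSubmonoid.subset_closure hx, 0, zero_mem _, sub_zero x⟩
    | zero => exact ⟨0, zero_mem _, 0, zero_mem _, sub_zero 0⟩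
    | add x y _ _ hx hy =>
      obtain ⟨a, ha, b, hb, rfl⟩ := hx
      obtain ⟨a', ha', b', hb', rfl⟩ := hy
      exact ⟨a + a', add_mem ha ha', b + b', add_mem hb hb', by ring⟩
    | neg x _ hx =>
      obtain ⟨a, ha, b, hb, rfl⟩ := hx
      exact ⟨b, hb, a, ha, by ring⟩
  obtain ⟨n, hn⟩ := exists_nat_ge (L / (a - b))
  rw [div_le_iff₀ hd0] at hn
  refine ⟨(Finset.range (n + 1)).image fun i => i • a + (n - i) • b, ?_, n * b, ?_⟩
  · simp only [Finset.mem_image, forall_exists_index, and_imp]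
    rintro s i - rfl
    exact add_mem (nsmul_mem ha _) (nsmul_mem hb _)
  · intro x hx
    have hx0 : 0 ≤ (x - n * b) / (a - b) := div_nonneg (by linarith [hx.1]) hd0.le
    set i := ⌊(x - n * b) / (a - b)⌋₊ with hi
    have hi1 := Nat.floor_le hx0
    have hi2 := Nat.lt_floor_add_one ((x - n * b) / (a - b))
    rw [← hi, le_div_iff₀ hd0] at hi1
    rw [← hi, div_lt_iff₀ hd0] at hi2
    have hin : i ≤ n := by
      have : (i : ℝ) ≤ n := by
        by_contra h
        push Not at h
        nlinarith [hx.2]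
      exact_mod_cast this
    refine ⟨_, Finset.mem_image_of_mem _ (Finset.mem_range.2 (Nat.lt_succ_of_le hin)), ?_⟩
    simp only [nsmul_eq_mul]
    rw [Nat.cast_sub hin, abs_lt]
    constructor <;> nlinarith

/-- The weighted average over the last period, which is constant on solutions of the homogeneous
renewal equation. -/
noncomputable def renewalIntegral (p τ : Fin N → ℝ) (f : ℝ → ℝ) (t : ℝ) : ℝ :=
  ∑ j, p j * ∫ x in (t - τ j)..t, f x

theorem hasDerivAt_renewalIntegral (hp1 : ∑ j, p j = 1) (hf : Continuous f) (t : ℝ) :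
    HasDerivAt (renewalIntegral p τ f) (f t - ∑ j, p j * f (t - τ j)) t := by
  have hI : renewalIntegral p τ f =
      fun t => ∑ j, p j * ((∫ x in (0 : ℝ)..t, f x) - ∫ x in (0 : ℝ)..(t - τ j), f x) := by
    funext t
    refine Finset.sum_congr rfl fun j _ => ?_
    rw [intervalIntegral.integral_interval_sub_left] <;> exact hf.intervalIntegrable _ _
  have hP : ∀ t, HasDerivAt (fun t => ∫ x in (0 : ℝ)..t, f x) (f t) t := fun t =>
    hf.integral_hasStrictDerivAt 0 t |>.hasDerivAt
  have hd : f t - ∑ j, p j * f (t - τ j) = ∑ j, p j * (f t - f (t - τ j)) := by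
    simp_rw [mul_sub, Finset.sum_sub_distrib, ← Finset.sum_mul, hp1, one_mul]
  rw [hI, hd]
  refine HasDerivAt.fun_sum fun j _ => HasDerivAt.const_mul _ ((hP t).sub ?_)
  exact HasDerivAt.comp_sub_const t (τ j) (hP (t - τ j))

theorem antitoneOn_renewalIntegral (hp1 : ∑ j, p j = 1) (hf : Continuous f) {T : ℝ}
    (hsub : ∀ t ≥ T, f t ≤ ∑ j, p j * f (t - τ j)) :
    AntitoneOn (renewalIntegral p τ f) (Set.Ici T) := by
  have hd := hasDerivAt_renewalIntegral (τ := τ) hp1 hf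
  refine antitoneOn_of_deriv_nonpos (convex_Ici T)
    (fun t _ => (hd t).continuousAt.continuousWithinAt)
    (fun t _ => (hd t).differentiableAt.differentiableWithinAt) fun t ht => ?_
  rw [interior_Ici] at ht
  rw [(hd t).deriv]
  linarith [hsub t (le_of_lt ht)]

theorem mul_le_integral_of_le {g : ℝ → ℝ} (hg : Continuous g) {a b A : ℝ} (hab : a ≤ b)
    (h : ∀ x ∈ Set.Icc a b, A ≤ g x) : (b - a) * A ≤ ∫ x in a..b, g x := by
  have := intervalIntegral.integral_mono_on (μ := volume) hab (continuous_const.intervalIntegrable a b)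
    (hg.intervalIntegrable a b) h
  simpa using this

theorem integral_le_mul_of_le {g : ℝ → ℝ} (hg : Continuous g) {a b A : ℝ} (hab : a ≤ b)
    (h : ∀ x ∈ Set.Icc a b, g x ≤ A) : ∫ x in a..b, g x ≤ (b - a) * A := by
  have := intervalIntegral.integral_mono_on (μ := volume) hab (hg.intervalIntegrable a b)
    (continuous_const.intervalIntegrable a b) h
  simpa using this

/-- A bounded uniformly continuous subsolution of a nonlattice renewal equation with finitely
many steps converges. -/
theorem exists_tendsto_of_renewal_le (hp : ∀ j, 0 < p j) (hp1 : ∑ j, p j = 1)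
    (hτ : ∀ j, 0 < τ j) (hG : Dense (AddSubgroup.closure (Set.range τ) : Set ℝ))
    (hf : UniformContinuous f) {B : ℝ} (hB : ∀ t, |f t| ≤ B) {T : ℝ}
    (hsub : ∀ t ≥ T, f t ≤ ∑ j, p j * f (t - τ j)) :
    ∃ M, Tendsto f atTop (𝓝 M) := by
  have hN : Nonempty (Fin N) := by
    by_contra h
    rw [not_nonempty_iff] at h
    simp at hp1
  set M := limsup f atTop with hMdef
  have hbu : IsBoundedUnder (· ≤ ·) atTop f := isBoundedUnder_of ⟨B, fun t => (abs_le.1 (hB t)).2⟩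
  have hbl : IsCoboundedUnder (· ≤ ·) atTop f :=
    (isBoundedUnder_of ⟨-B, fun t => (abs_le.1 (hB t)).1⟩ :
      IsBoundedUnder (· ≥ ·) atTop f).isCoboundedUnder_le
  have hM : ∀ η > 0, ∀ᶠ t in atTop, f t < M + η := fun η hη =>
    eventually_lt_of_limsup_lt (by rw [← hMdef]; linarith) hbu
  have hMf : ∀ η > 0, ∃ᶠ t in atTop, M - η < f t := fun η hη =>
    frequently_lt_of_lt_limsup hbl (by rw [← hMdef]; linarith)
  set l := atTop ⊓ comap f (𝓝 M) with hl
  have hlne : l.NeBot := by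
    have hcl : MapClusterPt M atTop f := by
      rw [mapClusterPt_iff_frequently]
      intro s hs
      obtain ⟨η, hη, hs⟩ := Metric.mem_nhds_iff.1 hs
      refine ((hMf η hη).and_eventually (hM η hη)).mono fun t ht => hs ?_
      rw [mem_ball, Real.dist_eq, abs_lt]
      constructor <;> linarith [ht.1, ht.2]
    rw [hl, inf_comm]
    exact mapClusterPt_iff_ultrafilter.1 hcl |>.elim fun U hU =>
      U.neBot.mono (le_inf (tendsto_iff_comap.1 hU.2) hU.1)
  have hlM : Tendsto f l (𝓝 M) := tendsto_comap.mono_left inf_le_right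
  set μ := ∑ j, p j * τ j with hμ
  have hμ0 : 0 < μ := Finset.sum_pos (fun j _ => mul_pos (hp j) (hτ j)) Finset.univ_nonempty
  set L := ∑ j, τ j with hL
  have hτL : ∀ j, τ j ≤ L := fun j =>
    Finset.single_le_sum (fun i _ => (hτ i).le) (Finset.mem_univ j)
  have hanti := antitoneOn_renewalIntegral hp1 hf.continuous hsub
  -- the average never drops below its value on the constant function `M`
  have hlow : ∀ t ≥ T, μ * M ≤ renewalIntegral p τ f t := by
    intro t ht
    suffices h : ∀ η > 0, μ * (M - η) ≤ renewalIntegral p τ f t by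
      have hlim : Tendsto (fun η : ℝ => μ * (M - η)) (𝓝[>] 0) (𝓝 (μ * (M - 0))) :=
        ((continuous_const.mul (continuous_const.sub continuous_id)).tendsto 0).mono_left
          nhdsWithin_le_nhds
      rw [sub_zero] at hlim
      exact le_of_tendsto hlim (eventually_nhdsWithin_of_forall h)
    intro η hη
    obtain ⟨δ, hδ, huc⟩ := Metric.uniformContinuous_iff.1 hf (η / 2) (by linarith)
    obtain ⟨S, hS, b, hb⟩ := exists_chain_of_dense_closure hG (L := L) hδ
    have h1 : ∀ᶠ u in l, ∀ s ∈ S, M - η / 2 < f (u - s) := by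
      rw [Filter.eventually_all_finset]
      intro s hs
      exact (tendsto_shift_of_mem_closure hp hp1 hsub hM inf_le_left hlM (hS s hs)).eventually
        (lt_mem_nhds (by linarith))
    have h2 : ∀ᶠ u in l, t + b ≤ u := Filter.Eventually.filter_mono inf_le_left
      (eventually_ge_atTop (t + b))
    obtain ⟨u, hu1, hu2⟩ := (h1.and h2).exists
    have hu : ∀ x ∈ Set.Icc (u - b - L) (u - b), M - η ≤ f x := by
      intro x hx
      obtain ⟨s, hs, hxs⟩ := hb (u - x) ⟨by linarith [hx.2], by linarith [hx.1]⟩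
      have h3 := hu1 s hs
      have h4 := huc (a := x) (b := u - s) (by
        rw [Real.dist_eq, abs_sub_comm]; convert hxs using 2; ring)
      rw [Real.dist_eq, abs_lt] at h4
      linarith [h4.1]
    refine le_trans ?_ (hanti ht (show T ≤ u - b by linarith) (by linarith : t ≤ u - b))
    rw [hμ, Finset.sum_mul]
    refine Finset.sum_le_sum fun j _ => ?_
    rw [mul_assoc]
    refine mul_le_mul_of_nonneg_left ?_ (hp j).le
    have h5 := mul_le_integral_of_le hf.continuous (a := u - b - τ j) (b := u - b) (A := M - η)
      (by linarith [hτ j]) fun x hx => hu x ⟨by linarith [hx.1, hτL j], hx.2⟩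
    simpa using h5
  refine ⟨M, tendsto_order.2 ⟨fun a ha => ?_, fun b hb => ?_⟩⟩
  · set κ := M - a with hκ
    have hκ0 : 0 < κ := by linarith
    obtain ⟨δ, hδ, huc⟩ := Metric.uniformContinuous_iff.1 hf (κ / 2) (by linarith)
    obtain ⟨i, hi⟩ := Finite.exists_min τ
    set θ := min (δ / 2) (τ i) with hθ
    have hθ0 : 0 < θ := lt_min (by linarith) (hτ i)
    set η := min (θ * κ / (4 * μ)) κ with hη
    have hη0 : 0 < η := lt_min (by positivity) hκ0
    obtain ⟨T', hT'⟩ := eventually_atTop.1 (hM η hη0)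
    filter_upwards [eventually_ge_atTop (T' + L), eventually_ge_atTop T] with t ht htT
    by_contra hcon
    push Not at hcon
    have hclose : ∀ x ∈ Set.Icc (t - θ) t, f x ≤ M - κ / 2 := by
      intro x hx
      have hθδ : θ ≤ δ / 2 := min_le_left _ _
      have h4 := huc (a := x) (b := t) (by
        rw [Real.dist_eq, abs_lt]; constructor <;> linarith [hx.1, hx.2])
      rw [Real.dist_eq, abs_lt] at h4
      linarith [h4.2]
    have hup : renewalIntegral p τ f t ≤ μ * M + μ * η - θ * (κ / 2) := by
      have : ∀ j, ∫ x in (t - τ j)..t, f x ≤ τ j * (M + η) - θ * (κ / 2) := by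
        intro j
        have hθj : θ ≤ τ j := (min_le_right _ _).trans (hi j)
        rw [← intervalIntegral.integral_add_adjacent_intervals
          (hf.continuous.intervalIntegrable (t - τ j) (t - θ))
          (hf.continuous.intervalIntegrable (t - θ) t)]
        have e1 := integral_le_mul_of_le hf.continuous (a := t - τ j) (b := t - θ) (A := M + η)
          (by linarith) fun x hx => (hT' x (by linarith [hx.1, hτL j])).le
        have e2 := integral_le_mul_of_le hf.continuous (a := t - θ) (b := t) (A := M - κ / 2)
          (by linarith) hclose
        nlinarith [mul_pos hθ0 hη0]
      calc renewalIntegral p τ f t ≤ ∑ j, p j * (τ j * (M + η) - θ * (κ / 2)) :=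
            Finset.sum_le_sum fun j _ => mul_le_mul_of_nonneg_left (this j) (hp j).le
        _ = μ * (M + η) - θ * (κ / 2) := by
            simp_rw [mul_sub, Finset.sum_sub_distrib, ← mul_assoc, ← Finset.sum_mul, hp1, one_mul, hμ]
        _ = _ := by ring
    have hηle : η ≤ θ * κ / (4 * μ) := min_le_left _ _
    rw [le_div_iff₀ (by positivity)] at hηle
    have := hlow t htT
    have hθκ : 0 < θ * κ := by positivity
    nlinarith
  · filter_upwards [hM (b - M) (by linarith)] with t ht
    linarith

end Renewal

theorem IsSimilarityR.exists_affine {φ : ℝ → ℝ} {ρ : ℝ} (h : IsSimilarityR φ ρ) :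
    ∃ e, |e| = ρ ∧ ∀ x, φ x = φ 0 + e * x := by
  have hsq : ∀ x y, (φ x - φ y) ^ 2 = ρ ^ 2 * (x - y) ^ 2 := fun x y => by
    have := h x y
    rw [Real.dist_eq, Real.dist_eq] at this
    rw [← sq_abs, this, mul_pow, sq_abs]
  refine ⟨φ 1 - φ 0, ?_, fun x => ?_⟩
  · simpa [Real.dist_eq] using h 1 0
  · have h1 := hsq x 0
    have h2 := hsq 1 0
    have h3 := hsq x 1
    have h4 : (φ x - φ 0 - (φ 1 - φ 0) * x) ^ 2 = 0 := by nlinarith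
    linarith [pow_eq_zero_iff (two_ne_zero) |>.1 h4]

theorem IsSimilarityR.injective {φ : ℝ → ℝ} {ρ : ℝ} (h : IsSimilarityR φ ρ) (hρ : 0 < ρ) :
    Function.Injective φ := fun x y hxy => by
  have := h x y
  rw [hxy, dist_self, zero_eq_mul] at this
  exact dist_eq_zero.1 (this.resolve_left hρ.ne')

theorem IsSimilarityR.surjective {φ : ℝ → ℝ} {ρ : ℝ} (h : IsSimilarityR φ ρ) (hρ : 0 < ρ) :
    Function.Surjective φ := fun y => by
  obtain ⟨e, he, hφ⟩ := h.exists_affine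
  have : e ≠ 0 := by rintro rfl; simp at he; exact hρ.ne he
  exact ⟨(y - φ 0) / e, by rw [hφ]; field_simp; ring⟩

theorem IsSimilarityR.image_thickening {φ : ℝ → ℝ} {ρ : ℝ} (h : IsSimilarityR φ ρ) (hρ : 0 < ρ)
    (F : Set ℝ) (ε : ℝ) : φ '' thickening (ε / ρ) F = thickening ε (φ '' F) := by
  ext z
  obtain ⟨x, rfl⟩ := h.surjective hρ z
  rw [(h.injective hρ).mem_set_image, mem_thickening_iff, mem_thickening_iff]
  simp only [Set.exists_mem_image, h x, lt_div_iff₀' hρ]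

open scoped Pointwise in
theorem IsSimilarityR.volume_image {φ : ℝ → ℝ} {ρ : ℝ} (h : IsSimilarityR φ ρ) (hρ : 0 < ρ)
    (S : Set ℝ) : (volume (φ '' S)).toReal = ρ * (volume S).toReal := by
  obtain ⟨e, he, hφ⟩ := h.exists_affine
  have h1 : φ '' S = (fun x => φ 0 + x) '' (e • S) := by
    rw [← Set.image_smul, Set.image_image]
    exact Set.image_congr fun x _ => by rw [hφ x, smul_eq_mul]
  rw [h1, Set.image_add_left, measure_preimage_add, Measure.addHaar_smul, Module.finrank_self,
    pow_one, he, ENNReal.toReal_mul, ENNReal.toReal_ofReal hρ.le]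

theorem IsSimilarityR.tubeVol_image {φ : ℝ → ℝ} {ρ : ℝ} (h : IsSimilarityR φ ρ) (hρ : 0 < ρ)
    (F : Set ℝ) (ε : ℝ) : tubeVol (φ '' F) ε = ρ * tubeVol F (ε / ρ) := by
  rw [tubeVol, ← h.image_thickening hρ, h.volume_image hρ, tubeVol]

section SelfSimilar

variable {N : ℕ} {φ : Fin N → ℝ → ℝ} {r : Fin N → ℝ}

theorem tubeVol_le_sum (hr : ∀ j, 0 < r j) (hsim : ∀ j, IsSimilarityR (φ j) (r j)) {F : Set ℝ}
    (hFinv : F = ⋃ j, φ j '' F) (ε : ℝ) :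
    tubeVol F ε ≤ ∑ j, r j * tubeVol F (ε / r j) := by
  have h1 : thickening ε F = ⋃ j, thickening ε (φ j '' F) := by
    conv_lhs => rw [hFinv]
    exact thickening_iUnion ε _
  have h2 := measureReal_iUnion_fintype_le (μ := volume) fun j => thickening ε (φ j '' F)
  rw [← h1] at h2
  exact h2.trans_eq (Finset.sum_congr rfl fun j _ => (hsim j).tubeVol_image (hr j) F ε)

/-- The length of the part of the `ε`-neighbourhood of `F` inside `O`. -/
noncomputable def innerTubeVol (O F : Set ℝ) (ε : ℝ) : ℝ := (volume (thickening ε F ∩ O)).toReal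

theorem innerTubeVol_le_tubeVol (O : Set ℝ) {F : Set ℝ} (hF : Bornology.IsBounded F) (ε : ℝ) :
    innerTubeVol O F ε ≤ tubeVol F ε :=
  ENNReal.toReal_mono (volume_thickening_ne_top hF ε) (measure_mono Set.inter_subset_left)

theorem innerTubeVol_mono (O : Set ℝ) {F : Set ℝ} (hF : Bornology.IsBounded F) :
    Monotone (innerTubeVol O F) := fun _ ε h =>
  ENNReal.toReal_mono
    (measure_ne_top_of_subset Set.inter_subset_left (volume_thickening_ne_top hF ε))
    (measure_mono (Set.inter_subset_inter_left O (thickening_mono h F)))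

theorem exists_innerTubeVol_pos {O F : Set ℝ} (hO : IsOpen O) (hOne : O.Nonempty)
    (hF : Bornology.IsBounded F) (hFne : F.Nonempty) : ∃ ε > 0, 0 < innerTubeVol O F ε := by
  obtain ⟨x, hx⟩ := hOne
  obtain ⟨y, hy⟩ := hFne
  refine ⟨dist x y + 1, by positivity, ENNReal.toReal_pos ?_ ?_⟩
  · refine (IsOpen.measure_pos _ (isOpen_thickening.inter hO) ⟨x, ?_, hx⟩).ne'
    exact mem_thickening_iff.2 ⟨y, hy, by linarith⟩
  · exact measure_ne_top_of_subset Set.inter_subset_left (volume_thickening_ne_top hF _)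

theorem sum_le_innerTubeVol (hr : ∀ j, 0 < r j) (hsim : ∀ j, IsSimilarityR (φ j) (r j)) {O : Set ℝ}
    (hO : IsOpen O) (hsub : ∀ j, φ j '' O ⊆ O)
    (hdisj : Pairwise fun i j => Disjoint (φ i '' O) (φ j '' O))
    {F : Set ℝ} (hF : IsCompact F) (hFinv : F = ⋃ j, φ j '' F) (ε : ℝ) :
    ∑ j, r j * innerTubeVol O F (ε / r j) ≤ innerTubeVol O F ε := by
  have hop : ∀ j, IsOpen (φ j '' (thickening (ε / r j) F ∩ O)) := by
    intro j
    obtain ⟨e, he, hφ⟩ := (hsim j).exists_affine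
    have he0 : e ≠ 0 := by rintro rfl; simp at he; exact (hr j).ne he
    have h1 : φ j = (Homeomorph.addLeft (φ j 0)) ∘ (Homeomorph.mulLeft₀ e he0) := by
      funext x; simp [hφ x]
    rw [h1, Set.image_comp, Homeomorph.isOpen_image, Homeomorph.isOpen_image]
    exact isOpen_thickening.inter hO
  have hsubset : (⋃ j, φ j '' (thickening (ε / r j) F ∩ O)) ⊆ thickening ε F ∩ O := by
    refine Set.iUnion_subset fun j => Set.subset_inter ?_ ?_
    · refine (Set.image_mono Set.inter_subset_left).trans ?_
      rw [(hsim j).image_thickening (hr j)]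
      refine thickening_subset_of_subset ε ?_
      conv_rhs => rw [hFinv]
      exact Set.subset_iUnion (fun j => φ j '' F) j
    · exact (Set.image_mono Set.inter_subset_right).trans (hsub j)
  have hfin : volume (thickening ε F ∩ O) ≠ ⊤ :=
    measure_ne_top_of_subset Set.inter_subset_left (volume_thickening_ne_top hF.isBounded ε)
  have hsum : volume (⋃ j, φ j '' (thickening (ε / r j) F ∩ O)) =
      ∑ j, volume (φ j '' (thickening (ε / r j) F ∩ O)) := by
    rw [measure_iUnion (fun i j hij => (hdisj hij).mono
      (Set.image_mono Set.inter_subset_right) (Set.image_mono Set.inter_subset_right))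
      fun j => (hop j).measurableSet, tsum_fintype]
  have hle := ENNReal.toReal_mono hfin (measure_mono hsubset)
  rw [hsum, ENNReal.toReal_sum fun j _ => measure_ne_top_of_subset
    ((Set.subset_iUnion _ j).trans hsubset) hfin] at hle
  simpa only [(hsim _).volume_image (hr _), innerTubeVol] using hle

/-- `W ε / ε ^ (1 - D)` in the logarithmic variable `t = -log ε`. -/
noncomputable def renormalize (D : ℝ) (W : ℝ → ℝ) (t : ℝ) : ℝ :=
  W (Real.exp (-t)) * Real.exp ((1 - D) * t)

theorem renormalize_neg_log (D : ℝ) (W : ℝ → ℝ) {ε : ℝ} (hε : 0 < ε) :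
    renormalize D W (-Real.log ε) = W ε / ε ^ (1 - D) := by
  rw [renormalize, neg_neg, Real.exp_log hε, Real.rpow_def_of_pos hε, div_eq_mul_inv,
    ← Real.exp_neg]
  congr 2; ring

theorem renormalize_sum (hr : ∀ j, 0 < r j) (D : ℝ) (W : ℝ → ℝ) (t : ℝ) :
    renormalize D (fun ε => ∑ j, r j * W (ε / r j)) t =
      ∑ j, r j ^ D * renormalize D W (t - -Real.log (r j)) := by
  simp only [renormalize, Finset.sum_mul]
  refine Finset.sum_congr rfl fun j _ => ?_
  have h1 : Real.exp (-(t - -Real.log (r j))) = Real.exp (-t) / r j := by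
    rw [show -(t - -Real.log (r j)) = -t - Real.log (r j) by ring, Real.exp_sub,
      Real.exp_log (hr j)]
  have h2 : Real.exp ((1 - D) * (t - -Real.log (r j))) =
      Real.exp ((1 - D) * t) * (r j * (r j ^ D)⁻¹) := by
    rw [Real.rpow_def_of_pos (hr j), ← Real.exp_neg]
    conv_rhs => rw [← Real.exp_log (hr j)]
    rw [Real.log_exp, ← Real.exp_add, ← Real.exp_add]
    congr 1; ring
  have h3 : r j ^ D ≠ 0 := (Real.rpow_pos_of_pos (hr j) D).ne'
  rw [h1, h2]
  field_simp

theorem renormalize_mono {D : ℝ} {W W' : ℝ → ℝ} (h : ∀ ε, W ε ≤ W' ε) (t : ℝ) :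
    renormalize D W t ≤ renormalize D W' t :=
  mul_le_mul_of_nonneg_right (h _) (Real.exp_pos _).le

/-- An upper bound on an initial window propagates along a renewal inequality. -/
theorem le_of_renewal_le {p τ : Fin N → ℝ} (hp : ∀ j, 0 ≤ p j) (hp1 : ∑ j, p j = 1)
    (hτ : ∀ j, 0 < τ j) {f : ℝ → ℝ} {T L B : ℝ} (hτL : ∀ j, τ j ≤ L)
    (hsub : ∀ t ≥ T, f t ≤ ∑ j, p j * f (t - τ j)) (hB : ∀ t ∈ Set.Icc (T - L) T, f t ≤ B) :
    ∀ t ≥ T, f t ≤ B := by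
  have hN : Nonempty (Fin N) := by
    by_contra h
    rw [not_nonempty_iff] at h
    simp at hp1
  obtain ⟨i, hi⟩ := Finite.exists_min τ
  have key : ∀ n : ℕ, ∀ t ∈ Set.Icc (T - L) (T + n * τ i), f t ≤ B := by
    intro n
    induction n with
    | zero => simpa using hB
    | succ n ih =>
      intro t ht
      rcases le_total t T with h | h
      · exact hB t ⟨ht.1, h⟩
      · calc f t ≤ ∑ j, p j * f (t - τ j) := hsub t h
          _ ≤ ∑ j, p j * B := by
            refine Finset.sum_le_sum fun j _ => mul_le_mul_of_nonneg_left (ih _ ⟨?_, ?_⟩) (hp j)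
            · linarith [hτL j]
            · have := ht.2
              push_cast at this
              linarith [hi j]
          _ = B := by rw [← Finset.sum_mul, hp1, one_mul]
  intro t ht
  obtain ⟨n, hn⟩ := exists_nat_ge ((t - T) / τ i)
  rw [div_le_iff₀ (hτ i)] at hn
  have hL : 0 ≤ L := (hτ i).le.trans (hτL i)
  exact key n t ⟨by linarith, by linarith⟩

theorem log_step_pos (hr : ∀ j, r j ∈ Set.Ioo (0 : ℝ) 1) (j : Fin N) : 0 < -Real.log (r j) :=
  neg_pos.2 (Real.log_neg (hr j).1 (hr j).2)

theorem exists_forall_renormalize_tubeVol_le (hr : ∀ j, r j ∈ Set.Ioo (0 : ℝ) 1)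
    (hsim : ∀ j, IsSimilarityR (φ j) (r j)) {F : Set ℝ} (hF : IsCompact F)
    (hFinv : F = ⋃ j, φ j '' F) {D : ℝ} (hD1 : D ≤ 1) (hD : ∑ j, r j ^ D = 1) :
    ∃ B, ∀ t ≥ 0, renormalize D (tubeVol F) t ≤ B := by
  set L := ∑ j, -Real.log (r j) with hL
  have hτ := log_step_pos hr
  have hτL : ∀ j, -Real.log (r j) ≤ L := fun j =>
    Finset.single_le_sum (f := fun j => -Real.log (r j)) (fun i _ => (hτ i).le) (Finset.mem_univ j)
  refine ⟨tubeVol F (Real.exp L), le_of_renewal_le (fun j => Real.rpow_nonneg (hr j).1.le D) hD hτ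
    hτL (fun t _ => ?_) fun t ht => ?_⟩
  · rw [← renormalize_sum fun j => (hr j).1]
    exact renormalize_mono (tubeVol_le_sum (fun j => (hr j).1) hsim hFinv) t
  · rw [renormalize]
    have h1 : tubeVol F (Real.exp (-t)) ≤ tubeVol F (Real.exp L) :=
      tubeVol_mono hF.isBounded (Real.exp_le_exp.2 (by linarith [ht.1]))
    have h2 : Real.exp ((1 - D) * t) ≤ 1 :=
      Real.exp_le_one_iff.2 (mul_nonpos_of_nonneg_of_nonpos (by linarith) ht.2)
    exact (mul_le_of_le_one_right (tubeVol_nonneg F _) h2).trans h1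

theorem exists_forall_le_renormalize_tubeVol (hr : ∀ j, r j ∈ Set.Ioo (0 : ℝ) 1)
    (hsim : ∀ j, IsSimilarityR (φ j) (r j)) {O : Set ℝ} (hO : IsOpen O) (hOne : O.Nonempty)
    (hsub : ∀ j, φ j '' O ⊆ O) (hdisj : Pairwise fun i j => Disjoint (φ i '' O) (φ j '' O))
    {F : Set ℝ} (hF : IsCompact F) (hFne : F.Nonempty)
    (hFinv : F = ⋃ j, φ j '' F) {D : ℝ} (hD1 : D ≤ 1) (hD : ∑ j, r j ^ D = 1) :
    ∃ c > 0, ∃ T, ∀ t ≥ T, c ≤ renormalize D (tubeVol F) t := by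
  set L := ∑ j, -Real.log (r j) with hL
  have hτ := log_step_pos hr
  have hτL : ∀ j, -Real.log (r j) ≤ L := fun j =>
    Finset.single_le_sum (f := fun j => -Real.log (r j)) (fun i _ => (hτ i).le) (Finset.mem_univ j)
  obtain ⟨ε, hε, hpos⟩ := exists_innerTubeVol_pos hO hOne hF.isBounded hFne
  set T := -Real.log ε with hT
  set c := innerTubeVol O F ε * Real.exp ((1 - D) * (T - L)) with hc
  refine ⟨c, mul_pos hpos (Real.exp_pos _), T, fun t ht => ?_⟩
  have key := le_of_renewal_le (f := fun t => -renormalize D (innerTubeVol O F) t) (B := -c)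
    (T := T) (fun j => Real.rpow_nonneg (hr j).1.le D) hD hτ hτL (fun t _ => ?_) (fun t ht => ?_) t ht
  · exact (neg_le_neg_iff.1 key).trans
      (renormalize_mono (innerTubeVol_le_tubeVol O hF.isBounded) t)
  · simp only [mul_neg, Finset.sum_neg_distrib, neg_le_neg_iff]
    rw [← renormalize_sum fun j => (hr j).1]
    exact renormalize_mono
      (sum_le_innerTubeVol (fun j => (hr j).1) hsim hO hsub hdisj hF hFinv) t
  · rw [neg_le_neg_iff, hc, renormalize]
    have h1 : ε ≤ Real.exp (-t) := by
      rw [← Real.log_le_iff_le_exp hε]; linarith [ht.2]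
    have h2 : (1 - D) * (T - L) ≤ (1 - D) * t :=
      mul_le_mul_of_nonneg_left ht.1 (by linarith)
    exact mul_le_mul (innerTubeVol_mono O hF.isBounded h1) (Real.exp_le_exp.2 h2)
      (Real.exp_pos _).le ENNReal.toReal_nonneg

theorem dense_closure_of_not_isLatticeVec (hN : 0 < N) (hr : ∀ j, r j ∈ Set.Ioo (0 : ℝ) 1)
    (h : ¬ IsLatticeVec r) :
    Dense (AddSubgroup.closure (Set.range fun j => -Real.log (r j)) : Set ℝ) := by
  refine (AddSubgroup.dense_or_cyclic _).resolve_right ?_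
  rintro ⟨a, ha⟩
  apply h
  have hτ := log_step_pos hr
  have hmem : ∀ j, ∃ n : ℤ, n • a = -Real.log (r j) := fun j => by
    rw [← AddSubgroup.mem_closure_singleton, ← ha]
    exact AddSubgroup.subset_closure ⟨j, rfl⟩
  choose n hn using hmem
  have hn' : ∀ j, ((n j).natAbs : ℝ) * |a| = -Real.log (r j) := fun j => by
    rw [Nat.cast_natAbs, Int.cast_abs, ← abs_mul, ← zsmul_eq_mul, hn, abs_of_pos (hτ j)]
  have hn0 : ∀ j, (n j).natAbs ≠ 0 := fun j h0 => by
    have := hn' j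
    rw [h0] at this
    simp only [Nat.cast_zero, zero_mul] at this
    exact (hτ j).ne this
  set d := Finset.univ.gcd fun j => (n j).natAbs with hd
  let i : Fin N := ⟨0, hN⟩
  have hdvd : ∀ j, d ∣ (n j).natAbs := fun j => Finset.gcd_dvd (Finset.mem_univ j)
  have hd0 : 0 < d := Nat.pos_of_dvd_of_pos (hdvd i) (Nat.pos_of_ne_zero (hn0 i))
  have ha0 : a ≠ 0 := by
    rintro rfl
    have := hn' i
    simp only [abs_zero, mul_zero] at this
    exact (hτ i).ne this
  refine ⟨Real.exp (-(d * |a|)), fun j => (n j).natAbs / d,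
    ⟨Real.exp_pos _, Real.exp_lt_one_iff.2 (neg_lt_zero.2 (by positivity))⟩,
    fun j => Nat.div_pos (Nat.le_of_dvd (Nat.pos_of_ne_zero (hn0 j)) (hdvd j)) hd0,
    Finset.gcd_div_eq_one (Finset.mem_univ i) (hn0 i), fun j => ?_⟩
  rw [← Real.exp_nat_mul]
  conv_lhs => rw [← Real.exp_log (hr j).1]
  congr 1
  have h1 : (((n j).natAbs / d : ℕ) : ℝ) * d = (n j).natAbs := by
    exact_mod_cast Nat.div_mul_cancel (hdvd j)
  linear_combination |a| * h1 + hn' j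

theorem dim_pos (hN : 2 ≤ N) (hr : ∀ j, r j ∈ Set.Ioo (0 : ℝ) 1) {D : ℝ}
    (hD : ∑ j, r j ^ D = 1) : 0 < D := by
  by_contra h
  push Not at h
  have : ∑ _j : Fin N, (1 : ℝ) ≤ ∑ j, r j ^ D :=
    Finset.sum_le_sum fun j _ => Real.one_le_rpow_of_pos_of_le_one_of_nonpos (hr j).1 (hr j).2.le h
  rw [hD] at this
  simp only [Finset.sum_const, Finset.card_univ, Fintype.card_fin, nsmul_eq_mul, mul_one] at this
  have h2 : (2 : ℝ) ≤ N := by exact_mod_cast hN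
  linarith

theorem dim_lt_one (hr : ∀ j, r j ∈ Set.Ioo (0 : ℝ) 1) (hsum : ∑ j, r j < 1) {D : ℝ}
    (hD : ∑ j, r j ^ D = 1) : D < 1 := by
  by_contra h
  push Not at h
  have : ∑ j, r j ^ D ≤ ∑ j, r j := Finset.sum_le_sum fun j _ => by
    simpa using Real.rpow_le_rpow_of_exponent_ge (hr j).1 (hr j).2.le h
  linarith

theorem uniformContinuous_renormalize_tubeVol {F : Set ℝ} (hF : IsCompact F) {D B : ℝ}
    (hD0 : 0 ≤ D) (hD1 : D ≤ 1) (hB : ∀ t ≥ 0, renormalize D (tubeVol F) t ≤ B) :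
    UniformContinuous fun t => renormalize D (tubeVol F) (max t 0) := by
  set f := renormalize D (tubeVol F) with hf
  have hf0 : ∀ t, 0 ≤ f t := fun t => mul_nonneg (tubeVol_nonneg F _) (Real.exp_pos _).le
  have hB0 : 0 ≤ B := (hf0 0).trans (hB 0 le_rfl)
  have hcomp : ∀ x t, x ≤ t → f x ≤ Real.exp (t - x) * f t ∧ f t ≤ Real.exp (t - x) * f x := by
    intro x t hxt
    have h1 : tubeVol F (Real.exp (-x)) ≤ Real.exp (t - x) * tubeVol F (Real.exp (-t)) := by
      have := tubeVol_mul_le hF (Real.exp_pos (-t)) (c := Real.exp (t - x))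
        (Real.one_le_exp (by linarith))
      rwa [← Real.exp_add, show t - x + -t = -x by ring] at this
    have h2 : tubeVol F (Real.exp (-t)) ≤ tubeVol F (Real.exp (-x)) :=
      tubeVol_mono hF.isBounded (Real.exp_le_exp.2 (by linarith))
    have h3 : Real.exp ((1 - D) * x) ≤ Real.exp ((1 - D) * t) :=
      Real.exp_le_exp.2 (by nlinarith)
    have h4 : Real.exp ((1 - D) * t) ≤ Real.exp (t - x) * Real.exp ((1 - D) * x) := by
      rw [← Real.exp_add]
      exact Real.exp_le_exp.2 (by nlinarith)
    constructor
    · calc f x ≤ (Real.exp (t - x) * tubeVol F (Real.exp (-t))) * Real.exp ((1 - D) * t) :=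
            mul_le_mul h1 h3 (Real.exp_pos _).le
              (mul_nonneg (Real.exp_pos _).le (tubeVol_nonneg F _))
        _ = _ := by rw [hf, renormalize, mul_assoc]
    · calc f t ≤ tubeVol F (Real.exp (-x)) * (Real.exp (t - x) * Real.exp ((1 - D) * x)) :=
            mul_le_mul h2 h4 (Real.exp_pos _).le (tubeVol_nonneg F _)
        _ = _ := by rw [hf, renormalize]; ring
  have hdiff : ∀ x ≥ 0, ∀ t ≥ 0, |f x - f t| ≤ (Real.exp |x - t| - 1) * B := by
    have hone : ∀ x ≥ 0, ∀ t ≥ 0, x ≤ t → |f x - f t| ≤ (Real.exp |x - t| - 1) * B := by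
      intro x hx t ht hxt
      obtain ⟨h1, h2⟩ := hcomp x t hxt
      have hE : 0 ≤ Real.exp (t - x) - 1 := by
        linarith [Real.one_le_exp (show 0 ≤ t - x by linarith)]
      rw [abs_sub_comm x t, abs_of_nonneg (by linarith : 0 ≤ t - x), abs_le]
      constructor
      · linarith [mul_le_mul_of_nonneg_left (hB x hx) hE]
      · linarith [mul_le_mul_of_nonneg_left (hB t ht) hE]
    intro x hx t ht
    rcases le_total x t with h | h
    · exact hone x hx t ht h
    · rw [abs_sub_comm, abs_sub_comm x t]
      exact hone t ht x hx h
  rw [Metric.uniformContinuous_iff]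
  intro η hη
  have hlim : Tendsto (fun s : ℝ => (Real.exp s - 1) * B) (𝓝 0) (𝓝 ((Real.exp 0 - 1) * B)) :=
    ((Real.continuous_exp.sub continuous_const).mul continuous_const).tendsto 0
  rw [Real.exp_zero, sub_self, zero_mul] at hlim
  obtain ⟨δ, hδ, h⟩ := Metric.eventually_nhds_iff.1 (hlim.eventually (gt_mem_nhds hη))
  refine ⟨δ, hδ, fun x t hxt => ?_⟩
  rw [Real.dist_eq]
  refine (hdiff _ (le_max_right _ _) _ (le_max_right _ _)).trans_lt (h ?_)
  rw [Real.dist_eq, sub_zero, abs_abs]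
  exact (abs_max_sub_max_le_abs x t 0).trans_lt hxt

theorem exists_tendsto_of_not_isLatticeVec (hN : 2 ≤ N) (hr : ∀ j, r j ∈ Set.Ioo (0 : ℝ) 1)
    (hsim : ∀ j, IsSimilarityR (φ j) (r j)) {O : Set ℝ} (hO : IsOpen O) (hOne : O.Nonempty)
    (hsub : ∀ j, φ j '' O ⊆ O) (hdisj : Pairwise fun i j => Disjoint (φ i '' O) (φ j '' O))
    {F : Set ℝ} (hF : IsCompact F) (hFne : F.Nonempty) (hFinv : F = ⋃ j, φ j '' F)
    (hrsum : ∑ j, r j < 1) {D : ℝ} (hD : ∑ j, r j ^ D = 1) (hlat : ¬ IsLatticeVec r) :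
    ∃ c : ℝ, 0 < c ∧ Tendsto (fun ε : ℝ => tubeVol F ε / ε ^ (1 - D)) (𝓝[>] (0 : ℝ)) (𝓝 c) := by
  have hD0 := (dim_pos hN hr hD).le
  have hD1 := (dim_lt_one hr hrsum hD).le
  have hτ := log_step_pos hr
  obtain ⟨B, hB⟩ := exists_forall_renormalize_tubeVol_le hr hsim hF hFinv hD1 hD
  obtain ⟨c, hc, T, hT⟩ :=
    exists_forall_le_renormalize_tubeVol hr hsim hO hOne hsub hdisj hF hFne hFinv hD1 hD
  set f := renormalize D (tubeVol F) with hf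
  have hf0 : ∀ t, 0 ≤ f t := fun t => mul_nonneg (tubeVol_nonneg F _) (Real.exp_pos _).le
  obtain ⟨M, hM⟩ := exists_tendsto_of_renewal_le (f := fun t => f (max t 0)) (B := B)
    (T := ∑ j, -Real.log (r j)) (fun j => Real.rpow_pos_of_pos (hr j).1 D) hD hτ
    (dense_closure_of_not_isLatticeVec (by omega) hr hlat)
    (uniformContinuous_renormalize_tubeVol hF hD0 hD1 hB)
    (fun t => by rw [abs_of_nonneg (hf0 _)]; exact hB _ (le_max_right _ _))
    (fun t ht => by
      have hτL : ∀ j, -Real.log (r j) ≤ t := fun j =>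
        (Finset.single_le_sum (f := fun j => -Real.log (r j)) (fun i _ => (hτ i).le)
          (Finset.mem_univ j)).trans ht
      have ht0 : 0 ≤ t := (hτ ⟨0, by omega⟩).le.trans (hτL _)
      have h1 : ∀ j, max (t - -Real.log (r j)) 0 = t - -Real.log (r j) := fun j =>
        max_eq_left (by linarith [hτL j])
      simp only [max_eq_left ht0, h1]
      rw [← renormalize_sum fun j => (hr j).1]
      exact renormalize_mono (tubeVol_le_sum (fun j => (hr j).1) hsim hFinv) t)
  have hM' : Tendsto f atTop (𝓝 M) := hM.congr' <| by
    filter_upwards [eventually_ge_atTop 0] with t ht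
    rw [max_eq_left ht]
  refine ⟨M, hc.trans_le (ge_of_tendsto hM' (eventually_atTop.2 ⟨T, hT⟩)), ?_⟩
  have hlog : Tendsto (fun ε : ℝ => -Real.log ε) (𝓝[>] 0) atTop :=
    tendsto_neg_atBot_atTop.comp Real.tendsto_log_nhdsGT_zero
  refine (hM'.comp hlog).congr' ?_
  filter_upwards [self_mem_nhdsWithin] with ε hε
  exact renormalize_neg_log D (tubeVol F) hε

end SelfSimilar

section Words

variable {N : ℕ} {φ : Fin N → ℝ → ℝ} {k : Fin N → ℕ} {ρ : ℝ}

/-- The composition of the maps `φ j` along a word. -/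
def wordMap (φ : Fin N → ℝ → ℝ) : List (Fin N) → ℝ → ℝ
  | [] => id
  | j :: w => φ j ∘ wordMap φ w

/-- The total exponent of a word in a lattice system. -/
def wordLevel (k : Fin N → ℕ) (w : List (Fin N)) : ℕ := (w.map k).sum

theorem wordMap_append (u v : List (Fin N)) (x : ℝ) :
    wordMap φ (u ++ v) x = wordMap φ u (wordMap φ v x) := by
  induction u with
  | nil => rfl
  | cons j u ih => exact congrArg (φ j) ih

theorem wordLevel_append (u v : List (Fin N)) :
    wordLevel k (u ++ v) = wordLevel k u + wordLevel k v := by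
  simp [wordLevel]

theorem wordLevel_cons (j : Fin N) (v : List (Fin N)) :
    wordLevel k (j :: v) = k j + wordLevel k v := by
  simp [wordLevel]

theorem isSimilarityR_wordMap (hsim : ∀ j, IsSimilarityR (φ j) (ρ ^ k j)) (w : List (Fin N)) :
    IsSimilarityR (wordMap φ w) (ρ ^ wordLevel k w) := by
  induction w with
  | nil => intro x y; simp [wordMap, wordLevel]
  | cons j w ih =>
    intro x y
    rw [wordLevel_cons, pow_add, mul_assoc, ← ih x y, ← hsim j]
    rfl

theorem mapsTo_wordMap {S : Set ℝ} (hS : ∀ j, φ j '' S ⊆ S) (w : List (Fin N)) :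
    Set.MapsTo (wordMap φ w) S S := by
  induction w with
  | nil => exact Set.mapsTo_id S
  | cons j w ih => exact (Set.mapsTo_iff_image_subset.2 (hS j)).comp ih

theorem eq_nil_of_wordLevel_eq_zero (hk : ∀ j, 0 < k j) {w : List (Fin N)}
    (h : wordLevel k w = 0) : w = [] := by
  cases w with
  | nil => rfl
  | cons j w => have := hk j; rw [wordLevel_cons] at h; omega

theorem eq_of_append_eq_append (hk : ∀ j, 0 < k j) {u v u' v' : List (Fin N)}
    (h : u ++ v = u' ++ v') (hlev : wordLevel k u = wordLevel k u') : u = u' := by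
  rcases List.append_eq_append_iff.1 h with ⟨c, rfl, -⟩ | ⟨c, rfl, -⟩
  · rw [wordLevel_append] at hlev
    rw [eq_nil_of_wordLevel_eq_zero hk (by omega : wordLevel k c = 0), List.append_nil]
  · rw [wordLevel_append] at hlev
    rw [eq_nil_of_wordLevel_eq_zero hk (by omega : wordLevel k c = 0), List.append_nil]

theorem length_le_wordLevel (hk : ∀ j, 0 < k j) (w : List (Fin N)) : w.length ≤ wordLevel k w := by
  induction w with
  | nil => simp
  | cons j w ih => have := hk j; rw [wordLevel_cons, List.length_cons]; omega

theorem finite_setOf_wordLevel_eq (hk : ∀ j, 0 < k j) (n : ℕ) :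
    {w : List (Fin N) | wordLevel k w = n}.Finite :=
  (List.finite_length_le (Fin N) n).subset fun w hw =>
    (length_le_wordLevel hk w).trans_eq hw

theorem disjoint_wordMap_image {O : Set ℝ} (hinj : ∀ j, Function.Injective (φ j))
    (hsub : ∀ j, φ j '' O ⊆ O) (hdisj : Pairwise fun i j => Disjoint (φ i '' O) (φ j '' O))
    (hk : ∀ j, 0 < k j) {v w : List (Fin N)} (hlev : wordLevel k v = wordLevel k w)
    (hne : v ≠ w) : Disjoint (wordMap φ v '' O) (wordMap φ w '' O) := by
  induction v generalizing w with
  | nil => exact absurd (eq_nil_of_wordLevel_eq_zero hk hlev.symm).symm hne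
  | cons i v ih =>
    cases w with
    | nil => exact absurd (eq_nil_of_wordLevel_eq_zero hk hlev) hne
    | cons j w =>
      simp only [wordMap, Set.image_comp]
      by_cases hij : i = j
      · subst hij
        rw [wordLevel_cons, wordLevel_cons] at hlev
        exact Set.disjoint_image_of_injective (hinj i) (ih (by omega) fun h => hne (by rw [h]))
      · exact (hdisj hij).mono (Set.image_mono (mapsTo_wordMap hsub v).image_subset)
          (Set.image_mono (mapsTo_wordMap hsub w).image_subset)

/-- Every point of the attractor has an address whose level lies in a given window. -/
theorem exists_wordMap_eq {F : Set ℝ} (hFinv : F = ⋃ j, φ j '' F) (hk : ∀ j, 0 < k j) {K : ℕ}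
    (hK0 : 0 < K) (hkK : ∀ j, k j ≤ K) (n : ℕ) {x : ℝ} (hx : x ∈ F) :
    ∃ v, n ≤ wordLevel k v ∧ wordLevel k v < n + K ∧ ∃ y ∈ F, wordMap φ v y = x := by
  induction n with
  | zero => exact ⟨[], by simp, by simpa [wordLevel] using hK0, x, hx, rfl⟩
  | succ n ih =>
    obtain ⟨v, h1, h2, y, hy, rfl⟩ := ih
    by_cases hlt : n + 1 ≤ wordLevel k v
    · exact ⟨v, hlt, by omega, y, hy, rfl⟩
    · rw [hFinv] at hy
      obtain ⟨j, y', hy', rfl⟩ := Set.mem_iUnion.1 hy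
      have hlev : wordLevel k (v ++ [j]) = wordLevel k v + k j := by
        simp [wordLevel]
      have := hkK j
      have := hk j
      exact ⟨v ++ [j], by omega, by omega, y', hy', wordMap_append v [j] y'⟩

end Words

section Lattice

variable {N : ℕ} {φ : Fin N → ℝ → ℝ} {k : Fin N → ℕ} {ρ : ℝ}

/-- The words of comparable level whose pieces come close to the image of `z` under `w`. -/
def neighborWords (φ : Fin N → ℝ → ℝ) (k : Fin N → ℕ) (ρ : ℝ) (K : ℕ) (F : Set ℝ) (z : ℝ)
    (w : List (Fin N)) : Set (List (Fin N)) :=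
  {v | wordLevel k w ≤ wordLevel k v ∧ wordLevel k v < wordLevel k w + K ∧
    ∃ x ∈ F, dist (wordMap φ v x) (wordMap φ w z) < ρ ^ wordLevel k w}

theorem exists_bound_neighborWords (hρ : ρ ∈ Set.Ioo (0 : ℝ) 1) (hk : ∀ j, 0 < k j)
    (hsim : ∀ j, IsSimilarityR (φ j) (ρ ^ k j)) {O : Set ℝ} (hO : IsOpen O) (hOne : O.Nonempty)
    (hsub : ∀ j, φ j '' O ⊆ O) (hdisj : Pairwise fun i j => Disjoint (φ i '' O) (φ j '' O))
    {F : Set ℝ} (hF : IsCompact F) (K : ℕ) (z : ℝ) :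
    ∃ B : ℕ, ∀ w, (neighborWords φ k ρ K F z w).Finite ∧
      (neighborWords φ k ρ K F z w).ncard ≤ B := by
  obtain ⟨o, ho⟩ := hOne
  obtain ⟨s, hs, hball⟩ := Metric.isOpen_iff.1 hO o ho
  obtain ⟨C, hC⟩ := hF.isBounded.subset_closedBall o
  have hρ0 := hρ.1
  set A := (C + (ρ ^ K)⁻¹) / s with hA
  set T : Finset (ℕ × ℤ) := Finset.range K ×ˢ Finset.Icc ⌊-A⌋ ⌊A⌋ with hT
  refine ⟨T.card, fun w => ?_⟩
  set g : List (Fin N) → ℕ × ℤ := fun v => (wordLevel k v - wordLevel k w,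
    ⌊(wordMap φ v o - wordMap φ w z) / (ρ ^ wordLevel k v * s)⌋) with hg
  have hmaps : ∀ v ∈ neighborWords φ k ρ K F z w, g v ∈ (T : Set (ℕ × ℤ)) := by
    rintro v ⟨h1, h2, x, hx, hxw⟩
    have hpv : 0 < ρ ^ wordLevel k v := pow_pos hρ0 _
    have hd : dist (wordMap φ v o) (wordMap φ w z) ≤
        ρ ^ wordLevel k v * C + ρ ^ wordLevel k w := by
      have e1 := isSimilarityR_wordMap hsim v o x
      have e2 : dist o x ≤ C := by rw [dist_comm]; exact hC hx
      have e3 := mul_le_mul_of_nonneg_left e2 hpv.le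
      have e4 := dist_triangle (wordMap φ v o) (wordMap φ v x) (wordMap φ w z)
      linarith
    have hpw : ρ ^ wordLevel k w ≤ ρ ^ wordLevel k v * (ρ ^ K)⁻¹ := by
      rw [le_mul_inv_iff₀ (pow_pos hρ0 K), ← pow_add]
      exact pow_le_pow_of_le_one hρ0.le hρ.2.le h2.le
    have habs : |(wordMap φ v o - wordMap φ w z) / (ρ ^ wordLevel k v * s)| ≤ A := by
      rw [abs_div, abs_of_pos (mul_pos hpv hs), hA, div_le_div_iff₀ (mul_pos hpv hs) hs]
      rw [Real.dist_eq] at hd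
      nlinarith
    rw [abs_le] at habs
    simp only [hT, hg, Finset.coe_product, Set.mem_prod, Finset.coe_range, Set.mem_Iio,
      Finset.coe_Icc, Set.mem_Icc]
    exact ⟨by omega, Int.floor_mono habs.1, Int.floor_mono habs.2⟩
  have hinj : Set.InjOn g (neighborWords φ k ρ K F z w) := by
    rintro v ⟨h1, -⟩ v' ⟨h1', -⟩ heq
    simp only [hg, Prod.mk.injEq] at heq
    have hlev : wordLevel k v = wordLevel k v' := by omega
    have hfl := heq.2
    rw [← hlev] at hfl
    have hlt := Int.abs_sub_lt_one_of_floor_eq_floor hfl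
    have hpv : 0 < ρ ^ wordLevel k v := pow_pos hρ0 _
    rw [← sub_div, abs_div, abs_of_pos (mul_pos hpv hs), div_lt_one (mul_pos hpv hs),
      sub_sub_sub_cancel_right, ← Real.dist_eq] at hlt
    by_contra hne
    have hsv := isSimilarityR_wordMap hsim v'
    obtain ⟨y, hy⟩ := hsv.surjective (pow_pos hρ0 _) (wordMap φ v o)
    have hyO : y ∈ O := by
      apply hball
      rw [mem_ball]
      rw [← hy, hsv, hlev] at hlt
      exact lt_of_mul_lt_mul_left hlt (pow_pos hρ0 _).le
    exact Set.disjoint_left.1 (disjoint_wordMap_image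
      (fun j => (hsim j).injective (pow_pos hρ0 _)) hsub hdisj hk hlev hne)
      (Set.mem_image_of_mem _ ho) ⟨y, hyO, hy⟩
  refine ⟨Set.Finite.of_injOn hmaps hinj T.finite_toSet, ?_⟩
  rw [← Set.ncard_coe_finset]
  exact Set.ncard_le_ncard_of_injOn g hmaps hinj T.finite_toSet

/-- A form of the strong open set condition: some point of the attractor has a neighbourhood all
of whose images meet the attractor only in the corresponding piece. -/
theorem exists_isolated_point (hρ : ρ ∈ Set.Ioo (0 : ℝ) 1) (hk : ∀ j, 0 < k j)
    (hsim : ∀ j, IsSimilarityR (φ j) (ρ ^ k j)) {O : Set ℝ} (hO : IsOpen O) (hOne : O.Nonempty)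
    (hsub : ∀ j, φ j '' O ⊆ O) (hdisj : Pairwise fun i j => Disjoint (φ i '' O) (φ j '' O))
    {F : Set ℝ} (hF : IsCompact F) (hFne : F.Nonempty) (hFinv : F = ⋃ j, φ j '' F) :
    ∃ z ∈ F, ∃ δ > 0, ∀ u,
      (∀ x ∈ F, dist x (wordMap φ u z) < δ * ρ ^ wordLevel k u → x ∈ wordMap φ u '' F) ∧
      ∀ u', wordLevel k u' = wordLevel k u → u' ≠ u →
        δ * ρ ^ wordLevel k u ≤ dist (wordMap φ u' z) (wordMap φ u z) := by
  obtain ⟨q, hq⟩ := hFne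
  have hρ0 := hρ.1
  have hFsub : ∀ j, φ j '' F ⊆ F := fun j => by
    conv_rhs => rw [hFinv]
    exact Set.subset_iUnion (fun j => φ j '' F) j
  set K := ∑ j, k j + 1 with hK
  have hkK : ∀ j, k j ≤ K := fun j =>
    (Finset.single_le_sum (fun i _ => Nat.zero_le (k i)) (Finset.mem_univ j)).trans (Nat.le_succ _)
  obtain ⟨B, hB⟩ := exists_bound_neighborWords hρ hk hsim hO hOne hsub hdisj hF K q
  set Γ := neighborWords φ k ρ K F q with hΓ
  obtain ⟨w, hw⟩ : ∃ w, ∀ w', (Γ w').ncard ≤ (Γ w).ncard := by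
    have hbdd : BddAbove (Set.range fun w => (Γ w).ncard) :=
      ⟨B, by rintro _ ⟨w, rfl⟩; exact (hB w).2⟩
    obtain ⟨w, hw⟩ := Nat.sSup_mem (Set.range_nonempty fun w => (Γ w).ncard) hbdd
    exact ⟨w, fun w' => (le_csSup hbdd ⟨w', rfl⟩).trans_eq hw.symm⟩
  have hshift : ∀ u, (fun v => u ++ v) '' Γ w = Γ (u ++ w) := by
    intro u
    refine Set.eq_of_subset_of_ncard_le ?_ ?_ (hB _).1
    · rintro _ ⟨v, ⟨h1, h2, x, hx, hxw⟩, rfl⟩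
      refine ⟨?_, ?_, x, hx, ?_⟩
      · simp only [wordLevel_append]; omega
      · simp only [wordLevel_append]; omega
      · simp only [wordMap_append, wordLevel_append]
        rw [isSimilarityR_wordMap hsim u, pow_add]
        exact mul_lt_mul_of_pos_left hxw (pow_pos hρ0 _)
    · rw [Set.ncard_image_of_injective _ (List.append_right_injective u)]
      exact hw _
  refine ⟨wordMap φ w q, mapsTo_wordMap hFsub w hq, ρ ^ wordLevel k w, pow_pos hρ0 _, fun u =>
    ⟨fun x hx hxu => ?_, fun u' hlev hne => ?_⟩⟩
  · obtain ⟨v, h1, h2, y, hy, rfl⟩ :=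
      exists_wordMap_eq hFinv hk (Nat.succ_pos _) hkK (wordLevel k (u ++ w)) hx
    have hv : v ∈ Γ (u ++ w) := ⟨h1, h2, y, hy, by
      rwa [wordMap_append, wordLevel_append, pow_add, mul_comm]⟩
    rw [← hshift] at hv
    obtain ⟨v', -, rfl⟩ := hv
    exact ⟨wordMap φ v' y, mapsTo_wordMap hFsub v' hy, (wordMap_append u v' y).symm⟩
  · by_contra! hcon
    have hv : u' ++ w ∈ Γ (u ++ w) := by
      refine ⟨?_, ?_, q, hq, ?_⟩
      · simp only [wordLevel_append]; omega
      · simp only [wordLevel_append]; omega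
      · rwa [wordMap_append, wordMap_append, wordLevel_append, pow_add, mul_comm]
    rw [← hshift] at hv
    obtain ⟨v', -, hv'⟩ := hv
    exact hne (eq_of_append_eq_append hk hv'.symm hlev)

/-- A closed null set of reals has a gap between any two of its points. -/
theorem exists_gap {F : Set ℝ} (hF : IsCompact F) (h0 : volume F = 0) {x y : ℝ} (hx : x ∈ F)
    (hy : y ∈ F) (hxy : x < y) :
    ∃ a ∈ F, ∃ b ∈ F, x ≤ a ∧ a < b ∧ b ≤ y ∧ ∀ z ∈ F, z ≤ a ∨ b ≤ z := by
  obtain ⟨p, hp, hpF⟩ : ∃ p ∈ Set.Ioo x y, p ∉ F := by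
    by_contra! h
    have := measure_mono_null (fun p hp => h p hp) h0
    rw [Real.volume_Ioo, ENNReal.ofReal_eq_zero] at this
    linarith
  obtain ⟨a, ha, hamax⟩ := (hF.inter_right isClosed_Icc : IsCompact (F ∩ Set.Icc x p)).exists_isGreatest
    ⟨x, hx, le_rfl, hp.1.le⟩
  obtain ⟨b, hb, hbmin⟩ := (hF.inter_right isClosed_Icc : IsCompact (F ∩ Set.Icc p y)).exists_isLeast
    ⟨y, hy, hp.2.le, le_rfl⟩
  have hap : a < p := lt_of_le_of_ne ha.2.2 fun h => hpF (h ▸ ha.1)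
  have hpb : p < b := lt_of_le_of_ne hb.2.1 fun h => hpF (h ▸ hb.1)
  refine ⟨a, ha.1, b, hb.1, ha.2.1, hap.trans hpb, hb.2.2, fun z hz => ?_⟩
  by_contra! h
  rcases le_total z p with hzp | hzp
  · exact h.1.not_ge (hamax ⟨hz, ha.2.1.trans h.1.le, hzp⟩)
  · exact h.2.not_ge (hbmin ⟨hz, hzp, h.2.le.trans hb.2.2⟩)

theorem exists_lt_near (hρ : ρ ∈ Set.Ioo (0 : ℝ) 1) (hk : ∀ j, 0 < k j)
    (hsim : ∀ j, IsSimilarityR (φ j) (ρ ^ k j)) {F : Set ℝ} (hF : IsCompact F)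
    (hFnt : F.Nontrivial) (hFinv : F = ⋃ j, φ j '' F) {z : ℝ} (hz : z ∈ F) {η : ℝ} (hη : 0 < η) :
    ∃ x ∈ F, ∃ y ∈ F, x < y ∧ dist x z < η ∧ dist y z < η := by
  have hρ0 := hρ.1
  have hFsub : ∀ j, φ j '' F ⊆ F := fun j => by
    conv_rhs => rw [hFinv]
    exact Set.subset_iUnion (fun j => φ j '' F) j
  have hdiam : 0 ≤ diam F := diam_nonneg
  obtain ⟨n, hn⟩ := exists_pow_lt_of_lt_one (div_pos hη (by linarith : 0 < diam F + 1)) hρ.2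
  rw [lt_div_iff₀ (by linarith)] at hn
  obtain ⟨v, h1, -, y, hy, rfl⟩ := exists_wordMap_eq hFinv hk (Nat.succ_pos (∑ j, k j))
    (fun j => (Finset.single_le_sum (fun i _ => Nat.zero_le (k i))
      (Finset.mem_univ j)).trans (Nat.le_succ _)) n hz
  have hnear : ∀ x ∈ F, dist (wordMap φ v x) (wordMap φ v y) < η := by
    intro x hx
    rw [isSimilarityR_wordMap hsim v]
    have e1 : ρ ^ wordLevel k v ≤ ρ ^ n := pow_le_pow_of_le_one hρ0.le hρ.2.le h1
    have e2 := dist_le_diam_of_mem hF.isBounded hx hy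
    calc ρ ^ wordLevel k v * dist x y ≤ ρ ^ n * (diam F + 1) :=
          mul_le_mul e1 (by linarith) dist_nonneg (pow_pos hρ0 n).le
      _ < η := hn
  obtain ⟨x₁, hx₁, x₂, hx₂, hne⟩ := hFnt
  have hne' := ((isSimilarityR_wordMap hsim v).injective (pow_pos hρ0 _)).ne hne
  have m₁ := mapsTo_wordMap hFsub v hx₁
  have m₂ := mapsTo_wordMap hFsub v hx₂
  rcases hne'.lt_or_gt with h | h
  · exact ⟨_, m₁, _, m₂, h, hnear _ hx₁, hnear _ hx₂⟩
  · exact ⟨_, m₂, _, m₁, h, hnear _ hx₂, hnear _ hx₁⟩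

/-- Some gap of a lattice self-similar set reappears, scaled, once for each word. -/
theorem exists_gap_copies (hρ : ρ ∈ Set.Ioo (0 : ℝ) 1) (hk : ∀ j, 0 < k j)
    (hsim : ∀ j, IsSimilarityR (φ j) (ρ ^ k j)) {O : Set ℝ} (hO : IsOpen O) (hOne : O.Nonempty)
    (hsub : ∀ j, φ j '' O ⊆ O) (hdisj : Pairwise fun i j => Disjoint (φ i '' O) (φ j '' O))
    {F : Set ℝ} (hF : IsCompact F) (hFnt : F.Nontrivial) (hFinv : F = ⋃ j, φ j '' F)
    (h0 : volume F = 0) :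
    ∃ ℓ > 0, ∀ n, ∀ W : Finset (List (Fin N)), (∀ w ∈ W, wordLevel k w = n) →
      ∃ A : Finset ℝ, A.card = W.card ∧
        ∀ a ∈ A, a ∈ F ∧ a + ρ ^ n * ℓ ∈ F ∧ ∀ x ∈ F, x ≤ a ∨ a + ρ ^ n * ℓ ≤ x := by
  classical
  have hρ0 := hρ.1
  have hFsub : ∀ j, φ j '' F ⊆ F := fun j => by
    conv_rhs => rw [hFinv]
    exact Set.subset_iUnion (fun j => φ j '' F) j
  obtain ⟨z, hz, δ, hδ, hiso⟩ :=
    exists_isolated_point hρ hk hsim hO hOne hsub hdisj hF hFnt.nonempty hFinv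
  obtain ⟨x₀, hx₀, y₀, hy₀, hlt, hxz, hyz⟩ :=
    exists_lt_near hρ hk hsim hF hFnt hFinv hz (by linarith : 0 < δ / 4)
  obtain ⟨a, ha, b, hb, hxa, hab, hby, hgap⟩ := exists_gap hF h0 hx₀ hy₀ hlt
  rw [Real.dist_eq, abs_lt] at hxz hyz
  have key : ∀ u : List (Fin N), ∃ α ∈ F, α + ρ ^ wordLevel k u * (b - a) ∈ F ∧
      (∀ x ∈ F, x ≤ α ∨ α + ρ ^ wordLevel k u * (b - a) ≤ x) ∧
      dist α (wordMap φ u z) < ρ ^ wordLevel k u * (δ / 4) := by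
    intro u
    have hs := isSimilarityR_wordMap hsim u
    set c := ρ ^ wordLevel k u with hc
    have hc0 : 0 < c := pow_pos hρ0 _
    have hma := mapsTo_wordMap hFsub u ha
    have hmb := mapsTo_wordMap hFsub u hb
    have hza : |a - z| < δ / 4 := by rw [abs_lt]; constructor <;> linarith
    have hzb : |b - z| < δ / 4 := by rw [abs_lt]; constructor <;> linarith
    have da : dist (wordMap φ u a) (wordMap φ u z) < c * (δ / 4) := by
      rw [hs]; exact mul_lt_mul_of_pos_left hza hc0
    have db : dist (wordMap φ u b) (wordMap φ u z) < c * (δ / 4) := by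
      rw [hs]; exact mul_lt_mul_of_pos_left hzb hc0
    obtain ⟨e, he, haff⟩ := hs.exists_affine
    have hcδ : 0 < c * δ := mul_pos hc0 hδ
    have hpull : ∀ x ∈ F, |x - wordMap φ u z| < c * (δ / 4) →
        ∃ y ∈ F, x = wordMap φ u 0 + e * y := by
      intro x hx hxu
      obtain ⟨y, hy, rfl⟩ := (hiso u).1 x hx (by rw [Real.dist_eq, ← hc]; linarith)
      exact ⟨y, hy, haff y⟩
    rw [Real.dist_eq, abs_lt] at da db
    rcases abs_choice e with h | h
    · have hec : e = c := by rw [← he, h]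
      have hdiff : wordMap φ u a + c * (b - a) = wordMap φ u b := by
        rw [haff a, haff b, hec]; ring
      refine ⟨wordMap φ u a, hma, by rwa [hdiff], fun x hx => ?_, ?_⟩
      · rw [hdiff]
        by_contra! hcon
        obtain ⟨y, hy, rfl⟩ := hpull x hx (by rw [abs_lt]; constructor <;> linarith)
        rw [haff a, haff b, hec] at hcon
        rcases hgap y hy with h' | h'
        · have := mul_le_mul_of_nonneg_left h' hc0.le
          linarith [hcon.1]
        · have := mul_le_mul_of_nonneg_left h' hc0.le
          linarith [hcon.2]
      · rw [Real.dist_eq, abs_lt]; exact da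
    · have hec : e = -c := by rw [← he, h, neg_neg]
      have hdiff : wordMap φ u b + c * (b - a) = wordMap φ u a := by
        rw [haff a, haff b, hec]; ring
      refine ⟨wordMap φ u b, hmb, by rwa [hdiff], fun x hx => ?_, ?_⟩
      · rw [hdiff]
        by_contra! hcon
        obtain ⟨y, hy, rfl⟩ := hpull x hx (by rw [abs_lt]; constructor <;> linarith)
        rw [haff a, haff b, hec] at hcon
        rcases hgap y hy with h' | h'
        · have := mul_le_mul_of_nonneg_left h' hc0.le
          linarith [hcon.2]
        · have := mul_le_mul_of_nonneg_left h' hc0.le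
          linarith [hcon.1]
      · rw [Real.dist_eq, abs_lt]; exact db
  choose α hα1 hα2 hα3 hα4 using key
  refine ⟨b - a, sub_pos.2 hab, fun n W hW => ⟨W.image α, Finset.card_image_of_injOn ?_, ?_⟩⟩
  · intro u hu u' hu' heq
    have hlu := hW u hu
    have hlu' := hW u' hu'
    by_contra hne
    have h1 := (hiso u').2 u (by rw [hlu, hlu']) hne
    have h2 := hα4 u
    have h3 := hα4 u'
    rw [heq, hlu] at h2
    rw [hlu'] at h1 h3
    have h4 := dist_triangle_left (wordMap φ u z) (wordMap φ u' z) (α u')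
    have := mul_pos (pow_pos hρ0 n) hδ
    linarith
  · intro x hx
    obtain ⟨u, hu, rfl⟩ := Finset.mem_image.1 hx
    have h1 := hα1 u
    have h2 := hα2 u
    have h3 := hα3 u
    rw [hW u hu] at h2 h3
    exact ⟨h1, h2, h3⟩

end Lattice

theorem nontrivial_of_tendsto_tubeVol_div {F : Set ℝ} (hFne : F.Nonempty) {D c : ℝ} (hD0 : 0 < D)
    (hc : 0 < c) (ht : Tendsto (fun ε : ℝ => tubeVol F ε / ε ^ (1 - D)) (𝓝[>] (0 : ℝ)) (𝓝 c)) :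
    F.Nontrivial := by
  rw [← Set.not_subsingleton_iff]
  intro hs
  obtain ⟨q, hq⟩ := hFne
  obtain rfl := hs.eq_singleton_of_mem hq
  have h0 : Tendsto (fun ε : ℝ => 2 * ε ^ D) (𝓝[>] 0) (𝓝 (2 * 0 ^ D)) :=
    ((Real.continuousAt_rpow_const 0 D (Or.inr hD0.le)).tendsto.mono_left
      nhdsWithin_le_nhds).const_mul 2
  rw [Real.zero_rpow hD0.ne', mul_zero] at h0
  refine hc.ne' (tendsto_nhds_unique ht (h0.congr' ?_))
  filter_upwards [self_mem_nhdsWithin] with ε (hε : 0 < ε)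
  rw [tubeVol_singleton q hε, eq_div_iff (Real.rpow_pos_of_pos hε _).ne', mul_assoc,
    ← Real.rpow_add hε, add_sub_cancel, Real.rpow_one]

theorem volume_eq_zero_of_tendsto_tubeVol_div {F : Set ℝ} (hF : Bornology.IsBounded F) {D c : ℝ}
    (hD1 : D < 1) (ht : Tendsto (fun ε : ℝ => tubeVol F ε / ε ^ (1 - D)) (𝓝[>] (0 : ℝ)) (𝓝 c)) :
    volume F = 0 := by
  have h0 : Tendsto (fun ε : ℝ => ε ^ (1 - D)) (𝓝[>] 0) (𝓝 (0 ^ (1 - D))) :=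
    (Real.continuousAt_rpow_const 0 (1 - D) (Or.inr (by linarith))).tendsto.mono_left
      nhdsWithin_le_nhds
  rw [Real.zero_rpow (by linarith)] at h0
  have h1 := ht.mul h0
  rw [mul_zero] at h1
  have h2 : (volume F).toReal ≤ 0 := by
    refine ge_of_tendsto h1 ?_
    filter_upwards [self_mem_nhdsWithin] with ε (hε : 0 < ε)
    rw [div_mul_cancel₀ _ (Real.rpow_pos_of_pos hε _).ne']
    exact ENNReal.toReal_mono (volume_thickening_ne_top hF ε)
      (measure_mono (self_subset_thickening hε F))
  exact ((ENNReal.toReal_eq_zero_iff _).1 (h2.antisymm ENNReal.toReal_nonneg)).resolve_right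
    hF.measure_lt_top.ne

section Counting

variable {N : ℕ} {φ : Fin N → ℝ → ℝ} {k : Fin N → ℕ} {ρ : ℝ}

/-- The words of a given level. -/
noncomputable def wordsOfLevel (hk : ∀ j, 0 < k j) (n : ℕ) : Finset (List (Fin N)) :=
  (finite_setOf_wordLevel_eq hk n).toFinset

theorem mem_wordsOfLevel (hk : ∀ j, 0 < k j) {n : ℕ} {w : List (Fin N)} :
    w ∈ wordsOfLevel hk n ↔ wordLevel k w = n := by
  simp [wordsOfLevel]

theorem exists_tubeVol_pow_le (hρ : ρ ∈ Set.Ioo (0 : ℝ) 1) (hk : ∀ j, 0 < k j)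
    (hsim : ∀ j, IsSimilarityR (φ j) (ρ ^ k j)) {F : Set ℝ} (hF : IsCompact F)
    (hFne : F.Nonempty) (hFinv : F = ⋃ j, φ j '' F) {K : ℕ} (hK0 : 0 < K) (hkK : ∀ j, k j ≤ K) :
    ∃ B > 0, ∀ n, tubeVol F (ρ ^ n) ≤
      B * ρ ^ n * ∑ m ∈ Finset.Ico n (n + K), ((wordsOfLevel hk m).card : ℝ) := by
  classical
  obtain ⟨q, hq⟩ := hFne
  have hρ0 := hρ.1
  have hdiam : 0 ≤ diam F := diam_nonneg
  refine ⟨2 * (diam F + 1), by positivity, fun n => ?_⟩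
  set S := (Finset.Ico n (n + K)).biUnion (wordsOfLevel hk) with hS
  have hρn : 0 < ρ ^ n := pow_pos hρ0 n
  have hsub : thickening (ρ ^ n) F ⊆ ⋃ w ∈ S, ball (wordMap φ w q) (ρ ^ n * (diam F + 1)) := by
    intro z hz
    obtain ⟨x, hx, hzx⟩ := mem_thickening_iff.1 hz
    obtain ⟨v, h1, h2, y, hy, rfl⟩ := exists_wordMap_eq hFinv hk hK0 hkK n hx
    refine Set.mem_biUnion (x := v) (Finset.mem_biUnion.2
      ⟨_, Finset.mem_Ico.2 ⟨h1, h2⟩, (mem_wordsOfLevel hk).2 rfl⟩) ?_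
    rw [mem_ball]
    have h3 := isSimilarityR_wordMap hsim v y q
    have h4 : ρ ^ wordLevel k v * dist y q ≤ ρ ^ n * diam F :=
      mul_le_mul (pow_le_pow_of_le_one hρ0.le hρ.2.le h1) (dist_le_diam_of_mem hF.isBounded hy hq)
        dist_nonneg hρn.le
    linarith [dist_triangle z (wordMap φ v y) (wordMap φ v q)]
  have hcard : (S.card : ℝ) ≤ ∑ m ∈ Finset.Ico n (n + K), ((wordsOfLevel hk m).card : ℝ) := by
    exact_mod_cast Finset.card_biUnion_le
  calc tubeVol F (ρ ^ n)
      ≤ (volume (⋃ w ∈ S, ball (wordMap φ w q) (ρ ^ n * (diam F + 1)))).toReal :=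
        ENNReal.toReal_mono ((measure_biUnion_lt_top S.finite_toSet
          fun _ _ => measure_ball_lt_top).ne) (measure_mono hsub)
    _ ≤ ∑ w ∈ S, (volume (ball (wordMap φ w q) (ρ ^ n * (diam F + 1)))).toReal :=
        measureReal_biUnion_finset_le S _
    _ = 2 * (diam F + 1) * ρ ^ n * S.card := by
        simp_rw [Real.volume_ball]
        rw [ENNReal.toReal_ofReal (by positivity), Finset.sum_const, nsmul_eq_mul]
        ring
    _ ≤ _ := by gcongr

/-- A Minkowski measurable attractor of a lattice system has, at infinitely many levels `m`, at
least of the order of `ρ ^ (-m D)` copies of that level. -/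
theorem exists_frequently_le_card_wordsOfLevel (hρ : ρ ∈ Set.Ioo (0 : ℝ) 1) (hk : ∀ j, 0 < k j)
    (hsim : ∀ j, IsSimilarityR (φ j) (ρ ^ k j)) {F : Set ℝ} (hF : IsCompact F)
    (hFne : F.Nonempty) (hFinv : F = ⋃ j, φ j '' F) {D c : ℝ} (hD0 : 0 < D) (hc : 0 < c)
    (ht : Tendsto (fun ε : ℝ => tubeVol F ε / ε ^ (1 - D)) (𝓝[>] (0 : ℝ)) (𝓝 c)) :
    ∃ b > 0, ∃ᶠ m in atTop, b ≤ ((wordsOfLevel hk m).card : ℝ) * (ρ ^ m) ^ D := by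
  have hρ0 := hρ.1
  set K := ∑ j, k j + 1 with hK
  have hkK : ∀ j, k j ≤ K := fun j =>
    (Finset.single_le_sum (fun i _ => Nat.zero_le (k i)) (Finset.mem_univ j)).trans (Nat.le_succ _)
  have hK0 : (0 : ℝ) < K := by rw [hK]; positivity
  obtain ⟨B, hB0, hB⟩ := exists_tubeVol_pow_le hρ hk hsim hF hFne hFinv (K := K)
    (Nat.succ_pos _) hkK
  have hρK : 0 < (ρ ^ K) ^ D := Real.rpow_pos_of_pos (pow_pos hρ0 K) D
  refine ⟨c * (ρ ^ K) ^ D / (4 * B * K), by positivity, frequently_atTop.2 fun a => ?_⟩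
  have hpow : Tendsto (fun n : ℕ => ρ ^ n) atTop (𝓝[>] 0) :=
    tendsto_nhdsWithin_iff.2 ⟨tendsto_pow_atTop_nhds_zero_of_lt_one hρ0.le hρ.2,
      Eventually.of_forall fun n => pow_pos hρ0 n⟩
  obtain ⟨n, hn, hna⟩ := (((ht.comp hpow).eventually_const_lt (half_lt_self hc)).and
    (eventually_ge_atTop a)).exists
  by_contra! hlt
  have hρn := pow_pos hρ0 n
  have hρnD := Real.rpow_pos_of_pos hρn D
  simp only [Function.comp, lt_div_iff₀ (Real.rpow_pos_of_pos hρn (1 - D))] at hn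
  have hsplit : ρ ^ n = (ρ ^ n) ^ (1 - D) * (ρ ^ n) ^ D := by
    rw [← Real.rpow_add hρn, sub_add_cancel, Real.rpow_one]
  have hterm : ∀ m ∈ Finset.Ico n (n + K),
      (ρ ^ n) ^ D * ((wordsOfLevel hk m).card : ℝ) ≤ c / (4 * B * K) := fun m hm => by
    obtain ⟨h1, h2⟩ := Finset.mem_Ico.1 hm
    have h3 : (ρ ^ n) ^ D * (ρ ^ K) ^ D ≤ (ρ ^ m) ^ D := by
      rw [← Real.mul_rpow hρn.le (pow_pos hρ0 K).le, ← pow_add]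
      exact Real.rpow_le_rpow (pow_pos hρ0 _).le
        (pow_le_pow_of_le_one hρ0.le hρ.2.le h2.le) hD0.le
    refine le_of_mul_le_mul_right ?_ hρK
    calc (ρ ^ n) ^ D * ((wordsOfLevel hk m).card : ℝ) * (ρ ^ K) ^ D
        = (wordsOfLevel hk m).card * ((ρ ^ n) ^ D * (ρ ^ K) ^ D) := by ring
      _ ≤ (wordsOfLevel hk m).card * (ρ ^ m) ^ D :=
        mul_le_mul_of_nonneg_left h3 (Nat.cast_nonneg _)
      _ ≤ c * (ρ ^ K) ^ D / (4 * B * K) := (hlt m (hna.trans h1)).le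
      _ = _ := by ring
  have hsum := Finset.sum_le_sum hterm
  rw [← Finset.mul_sum, Finset.sum_const, Nat.card_Ico, add_tsub_cancel_left, nsmul_eq_mul] at hsum
  have h4 : (K : ℝ) * (c / (4 * B * K)) = c / (4 * B) := by field_simp
  have h5 : c / 2 * (ρ ^ n) ^ (1 - D) < c / 4 * (ρ ^ n) ^ (1 - D) :=
    calc c / 2 * (ρ ^ n) ^ (1 - D) < _ := hn
      _ ≤ _ := hB n
      _ = B * (ρ ^ n) ^ (1 - D) * ((ρ ^ n) ^ D *
            ∑ m ∈ Finset.Ico n (n + K), ((wordsOfLevel hk m).card : ℝ)) := by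
          conv_lhs => rw [hsplit]
          ring
      _ ≤ B * (ρ ^ n) ^ (1 - D) * (c / (4 * B)) :=
          mul_le_mul_of_nonneg_left (hsum.trans_eq h4) (by positivity)
      _ = _ := by field_simp
  have h6 : c / 2 < c / 4 := lt_of_mul_lt_mul_right h5 (Real.rpow_pos_of_pos hρn _).le
  linarith

end Counting

theorem tendsto_second_diff_rpow (s : ℝ) :
    Tendsto (fun h : ℝ => h⁻¹ * ((1 + h - h ^ 2) ^ s + (1 - h - h ^ 2) ^ s - 2)) (𝓝[>] 0) (𝓝 0) := by
  have h1 : HasDerivAt (fun h : ℝ => 1 + h - h ^ 2) 1 0 := by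
    have := ((hasDerivAt_id' (0 : ℝ)).const_add 1).sub (hasDerivAt_pow 2 (0 : ℝ))
    norm_num at this
    exact this
  have h2 : HasDerivAt (fun h : ℝ => 1 - h - h ^ 2) (-1) 0 := by
    have := ((hasDerivAt_id' (0 : ℝ)).const_sub 1).sub (hasDerivAt_pow 2 (0 : ℝ))
    norm_num at this
    exact this
  have h3 := (h1.rpow_const (p := s) (Or.inl (by norm_num))).add
    (h2.rpow_const (p := s) (Or.inl (by norm_num)))
  have h4 := h3.tendsto_slope_zero_right
  simp only [smul_eq_mul, zero_add] at h4
  convert h4 using 2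
  · norm_num
  · norm_num

theorem not_tendsto_tubeVol_div_of_lattice {N : ℕ} {φ : Fin N → ℝ → ℝ} {k : Fin N → ℕ} {ρ : ℝ}
    (hρ : ρ ∈ Set.Ioo (0 : ℝ) 1) (hk : ∀ j, 0 < k j)
    (hsim : ∀ j, IsSimilarityR (φ j) (ρ ^ k j)) {O : Set ℝ} (hO : IsOpen O) (hOne : O.Nonempty)
    (hsub : ∀ j, φ j '' O ⊆ O) (hdisj : Pairwise fun i j => Disjoint (φ i '' O) (φ j '' O))
    {F : Set ℝ} (hF : IsCompact F) (hFne : F.Nonempty) (hFinv : F = ⋃ j, φ j '' F) {D c : ℝ}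
    (hD0 : 0 < D) (hD1 : D < 1) (hc : 0 < c) :
    ¬ Tendsto (fun ε : ℝ => tubeVol F ε / ε ^ (1 - D)) (𝓝[>] (0 : ℝ)) (𝓝 c) := by
  intro ht
  have hρ0 := hρ.1
  obtain ⟨ℓ, hℓ, hgap⟩ := exists_gap_copies hρ hk hsim hO hOne hsub hdisj hF
    (nontrivial_of_tendsto_tubeVol_div hFne hD0 hc ht) hFinv
    (volume_eq_zero_of_tendsto_tubeVol_div hF.isBounded hD1 ht)
  obtain ⟨b, hb, hfreq⟩ :=
    exists_frequently_le_card_wordsOfLevel hρ hk hsim hF hFne hFinv hD0 hc ht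
  set s := 1 - D with hs
  set ε : ℕ → ℝ := fun m => ρ ^ m * (ℓ / 2) with hεdef
  have hε : ∀ m, 0 < ε m := fun m => by have := pow_pos hρ0 m; positivity
  have hscale : ∀ u : ℝ, 0 < u →
      Tendsto (fun m => tubeVol F (u * ε m) / ε m ^ s) atTop (𝓝 (c * u ^ s)) := fun u hu => by
    have h1 : Tendsto (fun m => u * ε m) atTop (𝓝[>] 0) := by
      refine tendsto_nhdsWithin_iff.2 ⟨?_, Eventually.of_forall fun m => mul_pos hu (hε m)⟩
      simpa using ((tendsto_pow_atTop_nhds_zero_of_lt_one hρ0.le hρ.2).mul_const (ℓ / 2)).const_mul u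
    refine ((ht.comp h1).mul_const (u ^ s)).congr fun m => ?_
    have h2 := (Real.rpow_pos_of_pos hu s).ne'
    have h3 := (Real.rpow_pos_of_pos (hε m) s).ne'
    simp only [Function.comp]
    rw [Real.mul_rpow hu.le (hε m).le]
    field_simp
  have hbound : ∀ h : ℝ, 0 < h → h < 1 / 2 →
      c * ((1 + h - h ^ 2) ^ s + (1 - h - h ^ 2) ^ s - 2) ≤ h * -(2 * (ℓ / 2) ^ D * b) := by
    intro h h0 h1
    have hu : 0 < 1 + h - h ^ 2 := by nlinarith
    have hv : 0 < 1 - h - h ^ 2 := by nlinarith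
    have hlim := ((hscale _ hu).add (hscale _ hv)).sub ((hscale 1 one_pos).const_mul 2)
    rw [Real.one_rpow] at hlim
    have key := le_of_tendsto_of_frequently (b := h * -(2 * (ℓ / 2) ^ D * b)) hlim (hfreq.mono fun m hm => ?_)
    · linarith
    obtain ⟨A, hA, hAgap⟩ := hgap m (wordsOfLevel hk m) fun w => (mem_wordsOfLevel hk).1
    have h2ε : ρ ^ m * ℓ = 2 * ε m := by simp only [hεdef]; ring
    rw [h2ε] at hAgap
    have hmain := tubeVol_second_diff hF (hε m) h0 (by linarith)
      (mul_pos (pow_pos h0 2) (hε m)) A hAgap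
    rw [show (1 + h) * ε m - h ^ 2 * ε m = (1 + h - h ^ 2) * ε m by ring,
      show (1 - h) * ε m - h ^ 2 * ε m = (1 - h - h ^ 2) * ε m by ring, hA] at hmain
    have hpos := Real.rpow_pos_of_pos (hε m) s
    rw [one_mul, ← add_div, ← mul_div_assoc, ← sub_div, div_le_iff₀ hpos]
    refine hmain.trans ?_
    have hsplit : ε m = (ℓ / 2) ^ D * (ρ ^ m) ^ D * ε m ^ s := by
      rw [← Real.mul_rpow (by positivity) (pow_pos hρ0 m).le, mul_comm (ℓ / 2),
        ← Real.rpow_add (hε m), hs, add_sub_cancel, Real.rpow_one]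
    have hle : (ℓ / 2) ^ D * b * ε m ^ s ≤ ε m * (wordsOfLevel hk m).card := by
      conv_rhs => rw [hsplit]
      have : 0 ≤ (ℓ / 2) ^ D * ε m ^ s := by positivity
      nlinarith [mul_le_mul_of_nonneg_left hm this]
    nlinarith [mul_le_mul_of_nonneg_left hle h0.le]
  have hpsi := (tendsto_second_diff_rpow s).const_mul c
  rw [mul_zero] at hpsi
  have hneg : (0 : ℝ) ≤ -(2 * (ℓ / 2) ^ D * b) := by
    refine le_of_tendsto hpsi ?_
    filter_upwards [Ioo_mem_nhdsGT (by norm_num : (0 : ℝ) < 1 / 2)] with h hh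
    have h1 := hbound h hh.1 hh.2
    have h2 : h⁻¹ * (h * -(2 * (ℓ / 2) ^ D * b)) = -(2 * (ℓ / 2) ^ D * b) :=
      inv_mul_cancel_left₀ hh.1.ne' _
    rw [← h2, mul_left_comm]
    exact mul_le_mul_of_nonneg_left h1 (inv_pos.2 hh.1).le
  have : 0 < 2 * (ℓ / 2) ^ D * b := by positivity
  linarith

/-- A self-similar set `F ⊆ ℝ` arising from a system satisfying the open set condition with
`∑ r_j < 1`, of similarity dimension `D`, is Minkowski measurable — i.e.
`lim_{ε→0⁺} vol¹(F_ε)/ε^{1-D}` exists in `(0,∞)` — if and only if the scaling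
vector `r` is nonlattice. -/
theorem stmt9 {N : ℕ} (hN : 2 ≤ N)
    (φ : Fin N → ℝ → ℝ) (r : Fin N → ℝ) (hr : ∀ j, r j ∈ Set.Ioo (0 : ℝ) 1)
    (hsim : ∀ j, IsSimilarityR (φ j) (r j))
    (hOSC : ∃ V : Set ℝ, V.Nonempty ∧ IsOpen V ∧ (∀ j, φ j '' V ⊆ V) ∧
      Pairwise fun i j => Disjoint (φ i '' V) (φ j '' V))
    (F : Set ℝ) (hFne : F.Nonempty) (hFc : IsCompact F) (hFinv : F = ⋃ j, φ j '' F)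
    (hrsum : ∑ j, r j < 1)
    (D : ℝ) (hD : ∑ j, r j ^ D = 1) :
    (∃ c : ℝ, 0 < c ∧
      Tendsto (fun ε : ℝ => (volume (thickening ε F)).toReal / ε ^ (1 - D))
        (𝓝[>] (0 : ℝ)) (𝓝 c)) ↔
    ¬ IsLatticeVec r := by
  obtain ⟨O, hOne, hO, hsub, hdisj⟩ := hOSC
  constructor
  · rintro ⟨c, hc, ht⟩ ⟨ρ, k, hρ, hk, -, hrk⟩
    have hsim' : ∀ j, IsSimilarityR (φ j) (ρ ^ k j) := fun j => hrk j ▸ hsim j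
    exact not_tendsto_tubeVol_div_of_lattice hρ hk hsim' hO hOne hsub hdisj hFc hFne hFinv
      (dim_pos hN hr hD) (dim_lt_one hr hrsum hD) hc ht
  · exact exists_tendsto_of_not_isLatticeVec hN hr hsim hO hOne hsub hdisj hFc hFne hFinv hrsum hD
end

section
/- Let Φ = {φ_j}_{j=1}^N be a self-similar system on ℝ^m satisfying the open set condition, with attractor F and scaling vector r, and set D := D_r. If the additive subgroup of ℝ generated by {log r_1,…,log r_N} equals hℤ for some h > 0, then for every β ∈ [0,h) there exists a constant C_β > 0 such that N_B(F, e^{nh−β})/e^{D(nh−β)} → C_β as n → ∞ through the natural numbers. -/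
open Filter Topology Metric

/-- The box-counting function `N_B(A,x)`: the maximal number of pairwise disjoint closed
balls of radius `x⁻¹` whose centers lie in `A`. -/
noncomputable def boxCount {m : ℕ} (A : Set (EuclideanSpace ℝ (Fin m))) (x : ℝ) : ℕ :=
  sSup {n : ℕ | ∃ c : Fin n → EuclideanSpace ℝ (Fin m), (∀ i, c i ∈ A) ∧
    Pairwise fun i j => Disjoint (closedBall (c i) x⁻¹) (closedBall (c j) x⁻¹)}

/-- `φ` is a contracting similarity with scaling ratio `ρ`. -/
def IsSimilarity {X : Type*} [MetricSpace X] (φ : X → X) (ρ : ℝ) : Prop :=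
  ∀ x y, dist (φ x) (φ y) = ρ * dist x y

/-- A sequence dominated by averages of its earlier values stays below any bound that holds on a
window of full length. -/
theorem le_of_le_on_window {ι : Type*} [Fintype ι] {a : ℕ → ℝ} {p : ι → ℝ} {k : ι → ℕ} {K : ℕ}
    (hp : ∀ j, 0 < p j) (hp1 : ∑ j, p j = 1) (hk : ∀ j, 0 < k j) (hkK : ∀ j, k j ≤ K)
    (hsub : ∀ n, K ≤ n → a n ≤ ∑ j, p j * a (n - k j)) {n₁ : ℕ} {U : ℝ}
    (hU : ∀ n, n₁ ≤ n → n < n₁ + K → a n ≤ U) : ∀ n, n₁ ≤ n → a n ≤ U := by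
  intro n
  induction n using Nat.strong_induction_on with
  | _ n ih =>
    intro hn
    by_cases hlt : n < n₁ + K
    · exact hU n hn hlt
    calc a n ≤ ∑ j, p j * a (n - k j) := hsub n (by omega)
      _ ≤ ∑ j, p j * U := by
        refine Finset.sum_le_sum fun j _ => mul_le_mul_of_nonneg_left ?_ (hp j).le
        have h1 := hk j
        have h2 := hkK j
        exact ih _ (by omega) (by omega)
      _ = U := by rw [← Finset.sum_mul, hp1, one_mul]

/-- A deficit from an upper bound propagates along the semigroup generated by the delays. -/
theorem exists_deficit_propagation {ι : Type*} [Fintype ι] {a : ℕ → ℝ} {p : ι → ℝ} {k : ι → ℕ}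
    {K : ℕ} (hp : ∀ j, 0 < p j) (hp1 : ∑ j, p j = 1) (hkK : ∀ j, k j ≤ K)
    (hsub : ∀ n, K ≤ n → a n ≤ ∑ j, p j * a (n - k j)) {t : ℕ}
    (ht : t ∈ AddSubmonoid.closure (Set.range k)) :
    ∃ q : ℝ, 0 < q ∧ ∀ (U : ℝ) (N₀ : ℕ), (∀ n, N₀ ≤ n → a n ≤ U) →
      ∀ n, N₀ + K ≤ n → a (n + t) ≤ U - q * (U - a n) := by
  classical
  induction ht using AddSubmonoid.closure_induction with
  | mem t ht =>
    obtain ⟨j, rfl⟩ := ht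
    refine ⟨p j, hp j, fun U N₀ hU n hn => ?_⟩
    calc a (n + k j) ≤ ∑ i, p i * a (n + k j - k i) := hsub _ (by omega)
      _ = p j * a n + ∑ i ∈ Finset.univ.erase j, p i * a (n + k j - k i) := by
        rw [← Finset.add_sum_erase _ _ (Finset.mem_univ j), Nat.add_sub_cancel]
      _ ≤ p j * a n + ∑ i ∈ Finset.univ.erase j, p i * U := by
        gcongr with i _
        · exact (hp i).le
        · have := hkK i
          exact hU _ (by omega)
      _ = U - p j * (U - a n) := by
        have := Finset.add_sum_erase Finset.univ p (Finset.mem_univ j)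
        rw [← Finset.sum_mul, show ∑ i ∈ Finset.univ.erase j, p i = 1 - p j by linarith]
        ring
  | zero => exact ⟨1, one_pos, fun U N₀ hU n hn => by simp⟩
  | add s t _ _ hs ht =>
    obtain ⟨q, hq, h1⟩ := hs
    obtain ⟨q', hq', h2⟩ := ht
    refine ⟨q' * q, mul_pos hq' hq, fun U N₀ hU n hn => ?_⟩
    have h3 := h1 U N₀ hU n hn
    have h4 := h2 U N₀ hU (n + s) (by omega)
    have h5 : q' * (q * (U - a n)) ≤ q' * (U - a (n + s)) := by
      gcongr
      linarith
    rw [← add_assoc]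
    linarith

/-- A nonnegative sequence satisfying an aperiodic discrete renewal inequality converges. -/
theorem exists_tendsto_of_renewal_le_s11 {ι : Type*} [Fintype ι] {a : ℕ → ℝ} {p : ι → ℝ}
    {k : ι → ℕ} {K : ℕ} (ha : ∀ n, 0 ≤ a n) (hp : ∀ j, 0 < p j) (hp1 : ∑ j, p j = 1)
    (hk : ∀ j, 0 < k j) (hkK : ∀ j, k j ≤ K) (hgcd : Nat.setGcd (Set.range k) = 1)
    (hsub : ∀ n, K ≤ n → a n ≤ ∑ j, p j * a (n - k j)) :
    ∃ L, Tendsto a atTop (𝓝 L) := by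
  obtain ⟨n₀, hn₀⟩ := Nat.exists_mem_closure_of_ge (Set.range k)
  have hprop : ∃ q : ℝ, 0 < q ∧ ∀ (U : ℝ) (N₀ : ℕ), (∀ n, N₀ ≤ n → a n ≤ U) →
      ∀ n, N₀ + K ≤ n → ∀ t, n₀ ≤ t → t < n₀ + K → a (n + t) ≤ U - q * (U - a n) := by
    choose q hq hqa using fun t : {t // n₀ ≤ t} =>
      exists_deficit_propagation hp hp1 hkK hsub (hn₀ t t.2 (by simp [hgcd]))
    have hmin : ∃ q' : ℝ, 0 < q' ∧ ∀ i ∈ Finset.range K, q' ≤ q ⟨n₀ + i, by omega⟩ := by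
      induction Finset.range K using Finset.induction_on with
      | empty => exact ⟨1, one_pos, by simp⟩
      | insert i s _ ih =>
        obtain ⟨q', hq', h⟩ := ih
        refine ⟨min q' (q ⟨n₀ + i, by omega⟩), lt_min hq' (hq _), fun l hl => ?_⟩
        rcases Finset.mem_insert.1 hl with rfl | hl
        · exact min_le_right _ _
        · exact (min_le_left _ _).trans (h l hl)
    obtain ⟨q', hq', hmin⟩ := hmin
    refine ⟨q', hq', fun U N₀ hU n hn t ht htK => ?_⟩
    have h1 := hqa ⟨t, ht⟩ U N₀ hU n hn
    have h2 := hmin (t - n₀) (Finset.mem_range.2 (by omega))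
    have h3 : (⟨n₀ + (t - n₀), by omega⟩ : {t // n₀ ≤ t}) = ⟨t, ht⟩ := Subtype.ext (by simp; omega)
    rw [h3] at h2
    have h4 := mul_le_mul_of_nonneg_right h2 (sub_nonneg.2 (hU n (by omega)))
    linarith
  obtain ⟨q, hq, hprop⟩ := hprop
  set B : Set ℝ := {U | ∃ N₀, ∀ n, N₀ ≤ n → a n ≤ U}
  have hBne : B.Nonempty :=
    ⟨∑ n ∈ Finset.range K, a n, 0, le_of_le_on_window hp hp1 hk hkK hsub fun n _ hn =>
      Finset.single_le_sum (fun i _ => ha i) (Finset.mem_range.2 (by omega))⟩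
  have hBbdd : BddBelow B := ⟨0, fun U ⟨N₀, h⟩ => (ha N₀).trans (h N₀ le_rfl)⟩
  have hupper : ∀ U, sInf B < U → ∃ N₀, ∀ n, N₀ ≤ n → a n ≤ U := by
    intro U hU
    obtain ⟨U', ⟨N₀, hN₀⟩, h'⟩ := exists_lt_of_csInf_lt hBne hU
    exact ⟨N₀, fun n hn => (hN₀ n hn).trans h'.le⟩
  refine ⟨sInf B, tendsto_order.2 ⟨fun u hu => ?_, fun u hu => ?_⟩⟩
  · by_contra hcon
    rw [not_eventually] at hcon
    set ε := sInf B - u with hε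
    have hε0 : 0 < ε := sub_pos.2 hu
    have hqε : 0 < q * ε := mul_pos hq hε0
    obtain ⟨N₀, hN₀⟩ := hupper (sInf B + q * ε / 3) (by linarith)
    obtain ⟨n, hn, hlow⟩ := frequently_atTop.1 hcon (N₀ + K)
    have hnew : sInf B - q * ε / 3 ∈ B := by
      refine ⟨n + n₀, le_of_le_on_window hp hp1 hk hkK hsub fun l hl hl' => ?_⟩
      have h1 := hprop _ N₀ hN₀ n hn (l - n) (by omega) (by omega)
      rw [Nat.add_sub_cancel' (by omega)] at h1
      have h2 : q * ε ≤ q * (sInf B + q * ε / 3 - a n) := by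
        gcongr
        linarith [not_lt.1 hlow]
      linarith
    linarith [csInf_le hBbdd hnew]
  · obtain ⟨U, hU, hUu⟩ := exists_between hu
    obtain ⟨N₀, hN₀⟩ := hupper U hU
    filter_upwards [eventually_ge_atTop N₀] with n hn using (hN₀ n hn).trans_lt hUu

/-- In a proper normed space, the number of `s ε`-separated points in a ball of radius `A ε` is
bounded independently of `ε` and of the centre. -/
theorem exists_card_le_of_separated {E : Type*} [NormedAddCommGroup E] [NormedSpace ℝ E]
    [ProperSpace E] (A : ℝ) {s : ℝ} (hs : 0 < s) :
    ∃ M : ℕ, ∀ ε : ℝ, 0 < ε → ∀ (c : E) (T : Finset E), (∀ x ∈ T, dist x c ≤ A * ε) →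
      (∀ x ∈ T, ∀ y ∈ T, x ≠ y → s * ε ≤ dist x y) → T.card ≤ M := by
  classical
  obtain ⟨t, -, htf, ht⟩ :=
    (isCompact_closedBall (0 : E) A).finite_cover_balls (half_pos hs)
  refine ⟨htf.toFinset.card, fun ε hε c T hT hsep => ?_⟩
  have hcov : ∀ x ∈ T, ∃ z ∈ t, dist (ε⁻¹ • (x - c)) z < s / 2 := by
    intro x hx
    have hmem : ε⁻¹ • (x - c) ∈ closedBall (0 : E) A := by
      rw [mem_closedBall_zero_iff, norm_smul, Real.norm_of_nonneg (inv_nonneg.2 hε.le),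
        ← dist_eq_norm, inv_mul_le_iff₀ hε, mul_comm]
      exact hT x hx
    simpa using ht hmem
  choose! f hft hfd using hcov
  refine Finset.card_le_card_of_injOn f (fun x hx => by simpa using hft x hx) fun x hx y hy hxy => ?_
  by_contra hne
  have h1 := hfd x hx
  have h2 := hfd y hy
  rw [← hxy] at h2
  have h3 : dist (ε⁻¹ • (x - c)) (ε⁻¹ • (y - c)) = ε⁻¹ * dist x y := by
    rw [dist_smul₀, Real.norm_of_nonneg (inv_nonneg.2 hε.le), dist_sub_right]
  have h4 : s ≤ ε⁻¹ * dist x y := by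
    rw [le_inv_mul_iff₀ hε, mul_comm]
    exact hsep x hx y hy hne
  have h5 := dist_triangle_right (ε⁻¹ • (x - c)) (ε⁻¹ • (y - c)) (f x)
  linarith

/-- The cardinalities of packings of a bounded set by balls of a fixed radius are bounded. -/
theorem bddAbove_packing {m : ℕ} {A : Set (EuclideanSpace ℝ (Fin m))}
    (hA : Bornology.IsBounded A) {x : ℝ} (hx : 0 < x) :
    BddAbove {n : ℕ | ∃ c : Fin n → EuclideanSpace ℝ (Fin m), (∀ i, c i ∈ A) ∧
      Pairwise fun i j => Disjoint (closedBall (c i) x⁻¹) (closedBall (c j) x⁻¹)} := by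
  classical
  obtain ⟨R, hR⟩ := hA.subset_closedBall 0
  obtain ⟨M, hM⟩ := exists_card_le_of_separated (E := EuclideanSpace ℝ (Fin m)) R (inv_pos.2 hx)
  refine ⟨M, fun n ⟨c, hc, hdisj⟩ => ?_⟩
  have hx' : 0 ≤ x⁻¹ := (inv_pos.2 hx).le
  have hsep : ∀ i j, i ≠ j → x⁻¹ < dist (c i) (c j) := by
    intro i j hij
    by_contra hle
    exact Set.disjoint_left.1 (hdisj hij) (mem_closedBall_self hx')
      (mem_closedBall.2 (not_lt.1 hle))
  have hinj : Function.Injective c := by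
    intro i j hij
    by_contra hne
    have := hsep i j hne
    rw [hij, dist_self] at this
    linarith
  have hcard := hM 1 one_pos 0 (Finset.univ.image c) (by
    simp only [Finset.mem_image, Finset.mem_univ, true_and, mul_one]
    rintro _ ⟨i, rfl⟩
    exact hR (hc i)) (by
    simp only [Finset.mem_image, Finset.mem_univ, true_and, mul_one]
    rintro _ ⟨i, rfl⟩ _ ⟨j, rfl⟩ hne
    exact (hsep i j fun h => hne (by rw [h])).le)
  rwa [Finset.card_image_of_injective _ hinj, Finset.card_univ, Fintype.card_fin] at hcard

/-- Any finite packing has at most `boxCount A x` balls. -/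
theorem card_le_boxCount {m : ℕ} {A : Set (EuclideanSpace ℝ (Fin m))}
    (hA : Bornology.IsBounded A) {x : ℝ} (hx : 0 < x) {ι : Type*} [Fintype ι]
    (c : ι → EuclideanSpace ℝ (Fin m)) (hc : ∀ i, c i ∈ A)
    (hdisj : Pairwise fun i j => Disjoint (closedBall (c i) x⁻¹) (closedBall (c j) x⁻¹)) :
    Fintype.card ι ≤ boxCount A x :=
  le_csSup (bddAbove_packing hA hx) ⟨c ∘ (Fintype.equivFin ι).symm, fun _ => hc _,
    fun _ _ hij => hdisj ((Fintype.equivFin ι).symm.injective.ne hij)⟩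

/-- The maximal number of balls of a packing is attained. -/
theorem exists_packing_card_eq_boxCount {m : ℕ} {A : Set (EuclideanSpace ℝ (Fin m))}
    (hA : Bornology.IsBounded A) {x : ℝ} (hx : 0 < x) :
    ∃ c : Fin (boxCount A x) → EuclideanSpace ℝ (Fin m), (∀ i, c i ∈ A) ∧
      Pairwise fun i j => Disjoint (closedBall (c i) x⁻¹) (closedBall (c j) x⁻¹) :=
  Nat.sSup_mem (s := {n : ℕ | ∃ c : Fin n → EuclideanSpace ℝ (Fin m), (∀ i, c i ∈ A) ∧
    Pairwise fun i j => Disjoint (closedBall (c i) x⁻¹) (closedBall (c j) x⁻¹)})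
    ⟨0, Fin.elim0, fun i => i.elim0, fun i => i.elim0⟩ (bddAbove_packing hA hx)

/-- A maximal packing yields a covering by balls of twice the radius. -/
theorem exists_covering_card_eq_boxCount {m : ℕ} {A : Set (EuclideanSpace ℝ (Fin m))}
    (hA : Bornology.IsBounded A) {x : ℝ} (hx : 0 < x) :
    ∃ c : Fin (boxCount A x) → EuclideanSpace ℝ (Fin m), ∀ y ∈ A, ∃ i, dist y (c i) ≤ 2 * x⁻¹ := by
  obtain ⟨c, hc, hdisj⟩ := exists_packing_card_eq_boxCount hA hx
  refine ⟨c, fun y hy => ?_⟩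
  by_contra! hfar
  have hy_disj : ∀ i, Disjoint (closedBall y x⁻¹) (closedBall (c i) x⁻¹) := fun i =>
    closedBall_disjoint_closedBall (by linarith [hfar i])
  have hcard := card_le_boxCount hA hx (ι := Option (Fin (boxCount A x)))
    (fun o => o.elim y c) (by rintro (_ | i); exacts [hy, hc i]) (by
      rintro (_ | i) (_ | j) hij
      · exact (hij rfl).elim
      · exact hy_disj j
      · exact (hy_disj i).symm
      · exact hdisj fun h => hij (by rw [h]))
  simp at hcard

/-- A separated set of points close to `A` has cardinality at most a multiple of the box count. -/
theorem exists_card_le_mul_boxCount {m : ℕ} {A : Set (EuclideanSpace ℝ (Fin m))}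
    (hA : Bornology.IsBounded A) (R : ℝ) {s : ℝ} (hs : 0 < s) :
    ∃ M : ℕ, ∀ x : ℝ, 0 < x → ∀ T : Finset (EuclideanSpace ℝ (Fin m)),
      (∀ t ∈ T, ∃ y ∈ A, dist t y ≤ R * x⁻¹) →
      (∀ t ∈ T, ∀ u ∈ T, t ≠ u → s * x⁻¹ ≤ dist t u) → T.card ≤ M * boxCount A x := by
  classical
  obtain ⟨M, hM⟩ :=
    exists_card_le_of_separated (E := EuclideanSpace ℝ (Fin m)) (R + 2) hs
  refine ⟨M, fun x hx T hT hsep => ?_⟩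
  obtain ⟨c, hc⟩ := exists_covering_card_eq_boxCount hA hx
  have hnear : ∀ t ∈ T, ∃ i, dist t (c i) ≤ (R + 2) * x⁻¹ := by
    intro t ht
    obtain ⟨y, hy, hty⟩ := hT t ht
    obtain ⟨i, hi⟩ := hc y hy
    exact ⟨i, by linarith [dist_triangle t y (c i)]⟩
  rcases isEmpty_or_nonempty (Fin (boxCount A x)) with hempty | hne
  · have : T = ∅ := Finset.eq_empty_of_forall_notMem fun t ht => isEmptyElim (hnear t ht).choose
    simp [this]
  choose! f hf using hnear
  have := Finset.card_le_mul_card_image_of_maps_to (s := T) (t := Finset.univ) (f := f)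
    (fun _ _ => Finset.mem_univ _) M fun i _ => hM x⁻¹ (inv_pos.2 hx) (c i) _
      (by
        intro t ht
        obtain ⟨htT, hti⟩ := Finset.mem_filter.1 ht
        exact hti ▸ hf t htT)
      (fun t ht u hu => hsep t (Finset.mem_filter.1 ht).1 u (Finset.mem_filter.1 hu).1)
  simpa using this

/-- Subadditivity of the box count along a self-similar decomposition. -/
theorem boxCount_le_sum {m N : ℕ}
    {φ : Fin N → EuclideanSpace ℝ (Fin m) → EuclideanSpace ℝ (Fin m)} {r : Fin N → ℝ}
    (hr : ∀ j, 0 < r j) (hsim : ∀ j, IsSimilarity (φ j) (r j))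
    {F : Set (EuclideanSpace ℝ (Fin m))} (hF : Bornology.IsBounded F)
    (hFinv : F = ⋃ j, φ j '' F) {x : ℝ} (hx : 0 < x) :
    boxCount F x ≤ ∑ j, boxCount F (r j * x) := by
  classical
  obtain ⟨c, hc, hdisj⟩ := exists_packing_card_eq_boxCount hF hx
  have hpre : ∀ i, ∃ j, ∃ d ∈ F, φ j d = c i := fun i => by
    have := hc i
    rw [hFinv] at this
    simpa using this
  choose σ d hdF hd using hpre
  calc boxCount F x = ∑ j, (Finset.univ.filter fun i => σ i = j).card := by
        rw [← Finset.card_eq_sum_card_fiberwise (fun _ _ => Finset.mem_coe.2 (Finset.mem_univ _)),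
          Finset.card_univ, Fintype.card_fin]
    _ ≤ ∑ j, boxCount F (r j * x) := by
        refine Finset.sum_le_sum fun j _ => ?_
        have hcard := card_le_boxCount hF (mul_pos (hr j) hx) (ι := {i // σ i = j})
          (fun i => d i) (fun i => hdF i) (by
            intro i l hil
            refine Set.disjoint_left.2 fun z hz hz' => ?_
            have hmem : ∀ i : {i // σ i = j}, z ∈ closedBall (d i) (r j * x)⁻¹ →
                φ j z ∈ closedBall (c i) x⁻¹ := by
              rintro ⟨i, hij⟩ hi
              rw [mem_closedBall] at hi ⊢
              rw [← hd, hij, hsim]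
              calc r j * dist z (d i) ≤ r j * (r j * x)⁻¹ :=
                    mul_le_mul_of_nonneg_left hi (hr j).le
                _ = x⁻¹ := by
                    have := (hr j).ne'
                    field_simp
            exact Set.disjoint_left.1 (hdisj fun h => hil (Subtype.ext h)) (hmem i hz) (hmem l hz'))
        rwa [Fintype.card_subtype] at hcard

/-- A similarity of a finite-dimensional Euclidean space is surjective. -/
theorem IsSimilarity.surjective {m : ℕ} {φ : EuclideanSpace ℝ (Fin m) → EuclideanSpace ℝ (Fin m)}
    {ρ : ℝ} (hφ : IsSimilarity φ ρ) (hρ : 0 < ρ) : Function.Surjective φ := by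
  have hiso : Isometry fun x => ρ⁻¹ • φ x := Isometry.of_dist_eq fun x y => by
    rw [dist_smul₀, hφ, Real.norm_of_nonneg (inv_nonneg.2 hρ.le), inv_mul_cancel_left₀ hρ.ne']
  intro y
  have hlin : Function.Surjective hiso.affineIsometryOfStrictConvexSpace.linearIsometry :=
    LinearMap.surjective_of_injective
      (f := hiso.affineIsometryOfStrictConvexSpace.linearIsometry.toLinearMap)
      hiso.affineIsometryOfStrictConvexSpace.linearIsometry.injective
  have haff : Function.Surjective hiso.affineIsometryOfStrictConvexSpace.toAffineMap :=
    (AffineMap.linear_surjective_iff _).1 hlin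
  obtain ⟨x, hx⟩ := haff (ρ⁻¹ • y)
  exact ⟨x, smul_right_injective _ (inv_ne_zero hρ.ne') hx⟩

theorem IsSimilarity.ball_subset_image {m : ℕ}
    {φ : EuclideanSpace ℝ (Fin m) → EuclideanSpace ℝ (Fin m)} {ρ : ℝ} (hφ : IsSimilarity φ ρ)
    (hρ : 0 < ρ) (x : EuclideanSpace ℝ (Fin m)) (s : ℝ) :
    ball (φ x) (ρ * s) ⊆ φ '' ball x s := by
  intro y hy
  obtain ⟨z, rfl⟩ := hφ.surjective hρ y
  rw [mem_ball, hφ] at hy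
  exact ⟨z, lt_of_mul_lt_mul_left hy hρ.le, rfl⟩

theorem IsSimilarity.injective {X : Type*} [MetricSpace X] {φ : X → X} {ρ : ℝ}
    (hφ : IsSimilarity φ ρ) (hρ : 0 < ρ) : Function.Injective φ := by
  intro x y hxy
  have := hφ x y
  rw [hxy, dist_self] at this
  exact dist_eq_zero.1 ((mul_eq_zero.1 this.symm).resolve_left hρ.ne')

/-- Under the open set condition, at scale `exp (-n h)` there are at least a constant times
`exp (D n h)` separated points whose distance to the attractor is comparable to the scale. -/
theorem exists_separated_near_attractor {m N : ℕ}
    {φ : Fin N → EuclideanSpace ℝ (Fin m) → EuclideanSpace ℝ (Fin m)} {r : Fin N → ℝ}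
    (hr : ∀ j, 0 < r j) (hsim : ∀ j, IsSimilarity (φ j) (r j))
    (hOSC : ∃ V : Set (EuclideanSpace ℝ (Fin m)), V.Nonempty ∧ IsOpen V ∧
      (∀ j, φ j '' V ⊆ V) ∧ Pairwise fun i j => Disjoint (φ i '' V) (φ j '' V))
    {F : Set (EuclideanSpace ℝ (Fin m))} (hFne : F.Nonempty) (hFinv : F = ⋃ j, φ j '' F)
    {D : ℝ} (hD : ∑ j, r j ^ D = 1) {h : ℝ} (hh : 0 < h) {k : Fin N → ℕ} {K : ℕ}
    (hk : ∀ j, 0 < k j) (hkK : ∀ j, k j ≤ K) (hrk : ∀ j, r j = Real.exp (-(k j * h))) :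
    ∃ s R b : ℝ, 0 < s ∧ 0 < b ∧ ∀ n : ℕ, ∃ T : Finset (EuclideanSpace ℝ (Fin m)),
      b * Real.exp (D * (n * h)) ≤ T.card ∧
      (∀ t ∈ T, ∃ y ∈ F, dist t y ≤ R * Real.exp (-(n * h))) ∧
      ∀ t ∈ T, ∀ u ∈ T, t ≠ u → s * Real.exp (-(n * h)) ≤ dist t u := by
  classical
  obtain ⟨V, ⟨v, hv⟩, hVo, hVsub, hVdisj⟩ := hOSC
  obtain ⟨s, hs, hsV⟩ := Metric.isOpen_iff.1 hVo v hv
  obtain ⟨y₀, hy₀⟩ := hFne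
  have hFsub : ∀ j, ∀ y ∈ F, φ j y ∈ F := fun j y hy => by
    rw [hFinv]
    exact Set.mem_iUnion.2 ⟨j, y, hy, rfl⟩
  set R := dist v y₀ * Real.exp (K * h) with hR
  set b := Real.exp (-(|D| * (K * h))) with hb
  have hmain : ∀ n : ℕ, ∃ T : Finset (EuclideanSpace ℝ (Fin m)),
      b * Real.exp (D * (n * h)) ≤ T.card ∧
      (∀ t ∈ T, ∃ y ∈ F, dist t y ≤ R * Real.exp (-(n * h))) ∧
      (∀ t ∈ T, ball t (s * Real.exp (-(n * h))) ⊆ V) ∧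
      ∀ t ∈ T, ∀ u ∈ T, t ≠ u →
        Disjoint (ball t (s * Real.exp (-(n * h)))) (ball u (s * Real.exp (-(n * h)))) := by
    intro n
    induction n using Nat.strong_induction_on with
    | _ n ih =>
      by_cases hn : n < K
      · have hnK : (n : ℝ) * h ≤ K * h := by gcongr
        have hn0 : 0 ≤ (n : ℝ) * h := by positivity
        refine ⟨{v}, ?_, ?_, ?_, ?_⟩
        · rw [hb, ← Real.exp_add, Finset.card_singleton, Nat.cast_one, Real.exp_le_one_iff]
          nlinarith [abs_nonneg D, le_abs_self D, mul_le_mul_of_nonneg_left hnK (abs_nonneg D),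
            mul_le_mul_of_nonneg_right (le_abs_self D) hn0]
        · simp only [Finset.mem_singleton, forall_eq]
          refine ⟨y₀, hy₀, ?_⟩
          rw [hR, mul_assoc, ← Real.exp_add]
          exact le_mul_of_one_le_right dist_nonneg (Real.one_le_exp (by linarith))
        · simp only [Finset.mem_singleton, forall_eq]
          refine (ball_subset_ball ?_).trans hsV
          exact mul_le_of_le_one_right hs.le (Real.exp_le_one_iff.2 (by linarith))
        · simp only [Finset.mem_singleton]
          rintro t rfl u rfl hne
          exact (hne rfl).elim
      · have hkn : ∀ j, k j ≤ n := fun j => (hkK j).trans (not_lt.1 hn)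
        choose T hTcard hTF hTV hTdisj using fun j =>
          ih (n - k j) (by have := hk j; have := hkn j; omega)
        have hscale : ∀ j, Real.exp (-(n * h)) = r j * Real.exp (-((n - k j : ℕ) * h)) := by
          intro j
          rw [hrk, ← Real.exp_add, Nat.cast_sub (hkn j)]
          congr 1
          ring
        have hball : ∀ j x, ball (φ j x) (s * Real.exp (-(n * h))) ⊆
            φ j '' ball x (s * Real.exp (-((n - k j : ℕ) * h))) := by
          intro j x
          rw [hscale j, mul_left_comm]
          exact (hsim j).ball_subset_image (hr j) x _
        have hballV : ∀ j, ∀ x ∈ T j, ball (φ j x) (s * Real.exp (-(n * h))) ⊆ φ j '' V :=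
          fun j x hx => (hball j x).trans (Set.image_mono (hTV j x hx))
        have hdisj : ∀ i, ∀ x ∈ T i, ∀ j, ∀ y ∈ T j, φ i x ≠ φ j y →
            Disjoint (ball (φ i x) (s * Real.exp (-(n * h))))
              (ball (φ j y) (s * Real.exp (-(n * h)))) := by
          intro i x hx j y hy hne
          by_cases hij : i = j
          · subst hij
            exact ((Set.disjoint_image_iff ((hsim i).injective (hr i))).2
              (hTdisj i x hx y hy fun h => hne (by rw [h]))).mono (hball i x) (hball i y)
          · exact (hVdisj hij).mono (hballV i x hx) (hballV j y hy)
        refine ⟨Finset.univ.biUnion fun j => (T j).image (φ j), ?_, ?_, ?_, ?_⟩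
        · have hcard : (Finset.univ.biUnion fun j => (T j).image (φ j)).card =
              ∑ j, (T j).card := by
            rw [Finset.card_biUnion]
            · exact Finset.sum_congr rfl fun j _ =>
                Finset.card_image_of_injective _ ((hsim j).injective (hr j))
            · intro i _ j _ hij
              refine Finset.disjoint_left.2 fun z hzi hzj => ?_
              obtain ⟨x, hx, rfl⟩ := Finset.mem_image.1 hzi
              obtain ⟨y, hy, hxy⟩ := Finset.mem_image.1 hzj
              have hpos : 0 < s * Real.exp (-(n * h)) := by positivity
              refine Set.disjoint_left.1 (hVdisj hij)
                (hballV i x hx (mem_ball_self hpos)) ?_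
              rw [← hxy]
              exact hballV j y hy (mem_ball_self hpos)
          rw [hcard, Nat.cast_sum]
          calc b * Real.exp (D * (n * h))
              = ∑ j, r j ^ D * (b * Real.exp (D * (n * h))) := by
                rw [← Finset.sum_mul, hD, one_mul]
            _ = ∑ j, b * Real.exp (D * ((n - k j : ℕ) * h)) := by
                refine Finset.sum_congr rfl fun j _ => ?_
                rw [mul_left_comm, hrk, ← Real.exp_mul, ← Real.exp_add, Nat.cast_sub (hkn j)]
                congr 2
                ring
            _ ≤ ∑ j, ((T j).card : ℝ) := Finset.sum_le_sum fun j _ => hTcard j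
        · simp only [Finset.mem_biUnion, Finset.mem_univ, true_and, Finset.mem_image]
          rintro _ ⟨j, x, hx, rfl⟩
          obtain ⟨y, hy, hxy⟩ := hTF j x hx
          refine ⟨φ j y, hFsub j y hy, ?_⟩
          rw [hsim, hscale j, mul_left_comm]
          exact mul_le_mul_of_nonneg_left hxy (hr j).le
        · simp only [Finset.mem_biUnion, Finset.mem_univ, true_and, Finset.mem_image]
          rintro _ ⟨j, x, hx, rfl⟩
          exact (hballV j x hx).trans (hVsub j)
        · simp only [Finset.mem_biUnion, Finset.mem_univ, true_and, Finset.mem_image]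
          rintro _ ⟨i, x, hx, rfl⟩ _ ⟨j, y, hy, rfl⟩ hne
          exact hdisj i x hx j y hy hne
  refine ⟨s, R, b, hs, Real.exp_pos _, fun n => ?_⟩
  obtain ⟨T, h1, h2, -, h3⟩ := hmain n
  refine ⟨T, h1, h2, fun t ht u hu hne => ?_⟩
  by_contra hlt
  have hpos : 0 < s * Real.exp (-(n * h)) := by positivity
  exact Set.disjoint_left.1 (h3 t ht u hu hne) (mem_ball_self hpos) (mem_ball.2 (not_le.1 hlt))

/-- If the logarithms of ratios in `(0,1)` generate `hℤ`, the ratios are `exp (-k h)` with positive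
integers `k` of greatest common divisor one. -/
theorem exists_exponents_of_closure_eq {ι : Type*} {r : ι → ℝ}
    (hr : ∀ j, r j ∈ Set.Ioo (0 : ℝ) 1) {h : ℝ} (hh : 0 < h)
    (hgen : AddSubgroup.closure (Set.range fun j => Real.log (r j)) = AddSubgroup.zmultiples h) :
    ∃ k : ι → ℕ, (∀ j, 0 < k j) ∧ (∀ j, r j = Real.exp (-(k j * h))) ∧
      Nat.setGcd (Set.range k) = 1 := by
  have hex : ∀ j, ∃ k : ℕ, 0 < k ∧ r j = Real.exp (-(k * h)) := by
    intro j
    have hmem : Real.log (r j) ∈ AddSubgroup.zmultiples h := by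
      rw [← hgen]
      exact AddSubgroup.subset_closure ⟨j, rfl⟩
    obtain ⟨z, hz⟩ := AddSubgroup.mem_zmultiples_iff.1 hmem
    rw [zsmul_eq_mul] at hz
    have hneg : (z : ℝ) < 0 := by
      have hlog := Real.log_neg (hr j).1 (hr j).2
      rw [← hz] at hlog
      exact lt_of_not_ge fun hz0 => hlog.not_ge (mul_nonneg hz0 hh.le)
    have hz0 : z < 0 := by exact_mod_cast hneg
    have hcast : ((-z).toNat : ℝ) = -z := by
      have : ((-z).toNat : ℤ) = -z := Int.toNat_of_nonneg (by omega)
      exact_mod_cast this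
    refine ⟨(-z).toNat, by omega, ?_⟩
    rw [hcast, neg_mul, neg_neg, hz, Real.exp_log (hr j).1]
  choose k hk hrk using hex
  refine ⟨k, hk, hrk, ?_⟩
  set g := Nat.setGcd (Set.range k)
  have hle : AddSubgroup.closure (Set.range fun j => Real.log (r j)) ≤
      AddSubgroup.zmultiples ((g : ℝ) * h) := by
    rw [AddSubgroup.closure_le]
    rintro _ ⟨j, rfl⟩
    obtain ⟨l, hl⟩ : g ∣ k j := Nat.setGcd_dvd_of_mem ⟨j, rfl⟩
    refine AddSubgroup.mem_zmultiples_iff.2 ⟨-l, ?_⟩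
    simp only [hrk, Real.log_exp, hl, zsmul_eq_mul]
    push_cast
    ring
  rw [hgen] at hle
  obtain ⟨z, hz⟩ := AddSubgroup.mem_zmultiples_iff.1 (hle (AddSubgroup.mem_zmultiples h))
  rw [zsmul_eq_mul, ← mul_assoc] at hz
  have hz1 : (z : ℝ) * g = 1 := mul_right_cancel₀ hh.ne' (by rw [hz, one_mul])
  have hz2 : z * (g : ℤ) = 1 := by exact_mod_cast hz1
  have hdvd : (g : ℤ) ∣ 1 := ⟨z, by rw [mul_comm]; exact hz2.symm⟩
  exact Nat.dvd_one.1 (by exact_mod_cast hdvd)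

/-- Lattice case of Lalley's dichotomy: for a self-similar system on `ℝ^m` satisfying the
open set condition, with attractor `F` and similarity dimension `D`, if the additive group
generated by the `log r_j` equals `hℤ` with `h > 0`, then for every `β ∈ [0,h)` there is a
constant `C_β > 0` with `N_B(F, e^{nh-β}) / e^{D(nh-β)} → C_β` as `n → ∞`. -/
theorem stmt11 {m N : ℕ} (hN : 2 ≤ N)
    (φ : Fin N → EuclideanSpace ℝ (Fin m) → EuclideanSpace ℝ (Fin m))
    (r : Fin N → ℝ) (hr : ∀ j, r j ∈ Set.Ioo (0 : ℝ) 1)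
    (hsim : ∀ j, IsSimilarity (φ j) (r j))
    (hOSC : ∃ V : Set (EuclideanSpace ℝ (Fin m)), V.Nonempty ∧ IsOpen V ∧
      (∀ j, φ j '' V ⊆ V) ∧ Pairwise fun i j => Disjoint (φ i '' V) (φ j '' V))
    (F : Set (EuclideanSpace ℝ (Fin m)))
    (hFne : F.Nonempty) (hFc : IsCompact F) (hFinv : F = ⋃ j, φ j '' F)
    (D : ℝ) (hD : ∑ j, r j ^ D = 1)
    (h : ℝ) (hh : 0 < h)
    (hgen : AddSubgroup.closure (Set.range fun j => Real.log (r j)) =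
      AddSubgroup.zmultiples h) :
    ∀ β : ℝ, 0 ≤ β → β < h →
      ∃ C : ℝ, 0 < C ∧
        Tendsto (fun n : ℕ =>
            (boxCount F (Real.exp (n * h - β)) : ℝ) / Real.exp (D * (n * h - β)))
          atTop (𝓝 C) := by
  intro β _ _
  obtain ⟨k, hk, hrk, hgcd⟩ := exists_exponents_of_closure_eq hr hh hgen
  have hr0 : ∀ j, 0 < r j := fun j => (hr j).1
  set K := ∑ j, k j
  have hkK : ∀ j, k j ≤ K := fun j =>
    Finset.single_le_sum (f := k) (fun i _ => Nat.zero_le _) (Finset.mem_univ j)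
  obtain ⟨L, hL⟩ := exists_tendsto_of_renewal_le_s11
    (a := fun n : ℕ =>
      (boxCount F (Real.exp (n * h - β)) : ℝ) / Real.exp (D * (n * h - β)))
    (p := fun j => r j ^ D) (fun n => by positivity) (fun j => Real.rpow_pos_of_pos (hr0 j) D)
    hD hk hkK hgcd (by
      intro n hn
      have hcount := boxCount_le_sum hr0 hsim hFc.isBounded hFinv (Real.exp_pos (n * h - β))
      have hcast : (boxCount F (Real.exp (n * h - β)) : ℝ) ≤
          ∑ j, (boxCount F (r j * Real.exp (n * h - β)) : ℝ) := by exact_mod_cast hcount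
      calc _ ≤ (∑ j, (boxCount F (r j * Real.exp (n * h - β)) : ℝ)) /
            Real.exp (D * (n * h - β)) := by gcongr
        _ = _ := by
          rw [Finset.sum_div]
          refine Finset.sum_congr rfl fun j _ => ?_
          have hcs : ((n - k j : ℕ) : ℝ) = n - k j := Nat.cast_sub ((hkK j).trans hn)
          have h1 : r j * Real.exp (n * h - β) = Real.exp ((n - k j : ℕ) * h - β) := by
            rw [hrk, ← Real.exp_add, hcs]
            congr 1
            ring
          have h2 : Real.exp (D * (n * h - β)) =
              Real.exp (D * ((n - k j : ℕ) * h - β)) / r j ^ D := by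
            rw [hrk, ← Real.exp_mul, ← Real.exp_sub, hcs]
            congr 1
            ring
          rw [h1, h2, div_div_eq_mul_div]
          ring)
  obtain ⟨s, R, b, hs, hb, hT⟩ :=
    exists_separated_near_attractor hr0 hsim hOSC hFne hFinv hD hh hk hkK hrk
  obtain ⟨M, hM⟩ := exists_card_le_mul_boxCount hFc.isBounded (R * Real.exp (-β))
    (mul_pos hs (Real.exp_pos (-β)))
  have hlower : ∀ n : ℕ, b * Real.exp (D * β) / (M + 1) ≤
      (boxCount F (Real.exp (n * h - β)) : ℝ) / Real.exp (D * (n * h - β)) := by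
    intro n
    obtain ⟨T, hTcard, hTF, hTsep⟩ := hT n
    have hinv : Real.exp (-β) * (Real.exp (n * h - β))⁻¹ = Real.exp (-(n * h)) := by
      rw [← Real.exp_neg, ← Real.exp_add]
      congr 1
      ring
    have hcard := hM (Real.exp (n * h - β)) (Real.exp_pos _) T
      (by simpa only [mul_assoc, hinv] using hTF) (by simpa only [mul_assoc, hinv] using hTsep)
    have hcast : (T.card : ℝ) ≤ M * boxCount F (Real.exp (n * h - β)) := by exact_mod_cast hcard
    rw [div_le_div_iff₀ (by positivity) (Real.exp_pos _), mul_assoc, ← Real.exp_add,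
      show D * β + D * (n * h - β) = D * (n * h) by ring]
    have : (0 : ℝ) ≤ boxCount F (Real.exp (n * h - β)) := by positivity
    linarith
  exact ⟨L, (by positivity : 0 < b * Real.exp (D * β) / (M + 1)).trans_le
    (ge_of_tendsto' hL hlower), hL⟩
end
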